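/- Let r ≥ 2 be an integer, 0 < α ≤ (r-1)²/r², and let g ∈ ℝ[z_1,…,z_n] be a multi-affine real stable polynomial, g(z) = Σ_{A ⊆ [n]} a_A z^{A^c}, such that all roots of the diagonalization ḡ lie in [0,1], a_∅ = 1, and |a_{{i}}| ≤ α for every i ∈ [n]. Then maxroot(g_r) ≤ (√(1/r − α/(r−1)) + √α)², where g_r = Σ_{𝒮 ∈ 𝒫_r(n)} g_𝒮. -/

import Mathlib

open MvPolynomial Polynomial

/-- A polynomial with real coefficients is *real stable* if it does not vanish
when all variables have positive imaginary part. -/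
def RealStable {n : ℕ} (p : MvPolynomial (Fin n) ℝ) : Prop :=
  ∀ z : Fin n → ℂ, (∀ i, 0 < (z i).im) →
    MvPolynomial.eval z (MvPolynomial.map (algebraMap ℝ ℂ) p) ≠ 0

/-- A polynomial is *multi-affine* if it has degree at most 1 in each variable. -/
def MultiAffine {n : ℕ} (p : MvPolynomial (Fin n) ℝ) : Prop :=
  ∀ i, p.degreeOf i ≤ 1

/-- The diagonalization `p̄(x) = p(x,…,x)` of a multivariate polynomial. -/
noncomputable def diagPoly {n : ℕ} (p : MvPolynomial (Fin n) ℝ) : Polynomial ℝ :=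
  MvPolynomial.aeval (fun _ => Polynomial.X) p

/-- The exponent of the multi-affine monomial `∏_{i ∈ A} z_i`. -/
noncomputable def expOf {n : ℕ} (A : Finset (Fin n)) : Fin n →₀ ℕ :=
  ∑ i ∈ A, Finsupp.single i 1

/-- `∂^S p = (∏_{i ∈ S} ∂/∂z_i) p`. -/
noncomputable def pderivs {n : ℕ} (S : Finset (Fin n)) (p : MvPolynomial (Fin n) ℝ) :
    MvPolynomial (Fin n) ℝ :=
  S.toList.foldr (fun i q => MvPolynomial.pderiv i q) p

open scoped Classical in
/-- `𝒫_r(n)`: ordered partitions of `[n]` into `r` possibly empty subsets. -/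
noncomputable def Partitions (r n : ℕ) : Finset (Fin r → Finset (Fin n)) :=
  Finset.univ.filter
    (fun S => (∀ i j, i ≠ j → Disjoint (S i) (S j)) ∧ ∀ k, ∃ i, k ∈ S i)

/-- `g_𝒮(x) = ∏_{i=1}^r (diagonalization of ∂^{S_i^c} g)(x)`. -/
noncomputable def gPart {n r : ℕ} (g : MvPolynomial (Fin n) ℝ)
    (S : Fin r → Finset (Fin n)) : Polynomial ℝ :=
  ∏ i, diagPoly (pderivs (S i)ᶜ g)

/-- `g_r = Σ_{𝒮 ∈ 𝒫_r(n)} g_𝒮`. -/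
noncomputable def gSum (r : ℕ) {n : ℕ} (g : MvPolynomial (Fin n) ℝ) : Polynomial ℝ :=
  ∑ S ∈ Partitions r n, gPart g S

theorem Polynomial.Splits.exists_eq_C_mul_prod {K : Type*} [Field K] {f : Polynomial K}
    (hf : f.Splits) {d : ℕ} (hd : f.natDegree = d) :
    ∃ l : Fin d → K, f = Polynomial.C f.leadingCoeff * ∏ k, (Polynomial.X - Polynomial.C (l k)) := by
  have hlen : f.roots.toList.length = d := by
    rw [Multiset.length_toList, ← hf.natDegree_eq_card_roots, hd]
  refine ⟨fun k => f.roots.toList.get (k.cast hlen.symm), ?_⟩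
  conv_lhs => rw [hf.eq_prod_roots]
  congr 1
  conv_lhs => rw [← Multiset.coe_toList f.roots]
  rw [Multiset.map_coe, Multiset.prod_coe]
  subst hlen
  rw [← List.prod_ofFn]
  congr 1
  apply List.ext_get <;> simp

theorem norm_mul_im_pow_le_norm_prod {d : ℕ} (a : ℂ) (l : Fin d → ℂ) (hl : ∀ k, (l k).im ≤ 0)
    (t : ℂ) (ht : 0 ≤ t.im) :
    ‖a‖ * t.im ^ d ≤
      ‖(Polynomial.C a * ∏ k, (Polynomial.X - Polynomial.C (l k))).eval t‖ := by
  simp only [Polynomial.eval_mul, Polynomial.eval_C, Polynomial.eval_prod, Polynomial.eval_sub,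
    Polynomial.eval_X, norm_mul, norm_prod]
  gcongr
  calc t.im ^ d = ∏ _k : Fin d, t.im := by simp
    _ ≤ _ := by
      refine Finset.prod_le_prod (fun _ _ => ht) fun k _ => ?_
      calc t.im ≤ (t - l k).im := by simpa using hl k
        _ ≤ _ := (le_abs_self _).trans (Complex.abs_im_le_norm _)

/-- A complex polynomial without zeros in the open upper half-plane is bounded from below there by
its top coefficient times a power of the imaginary part. -/
theorem norm_coeff_mul_im_pow_le {d : ℕ} {f : Polynomial ℂ} (hd : f.natDegree ≤ d)
    (hf : ∀ t : ℂ, 0 < t.im → f.eval t ≠ 0) (t : ℂ) (ht : 0 ≤ t.im) :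
    ‖f.coeff d‖ * t.im ^ d ≤ ‖f.eval t‖ := by
  rcases hd.lt_or_eq with h | h
  · simp [Polynomial.coeff_eq_zero_of_natDegree_lt h]
  · obtain ⟨l, hl⟩ := (IsAlgClosed.splits f).exists_eq_C_mul_prod h
    have hc : f.coeff d = f.leadingCoeff := by rw [← h]; rfl
    rw [hc]
    conv_rhs => rw [hl]
    refine norm_mul_im_pow_le_norm_prod _ _ (fun k => ?_) t ht
    by_contra! hk
    apply hf _ hk
    rw [hl]
    simp only [Polynomial.eval_mul, Polynomial.eval_prod]
    rw [Finset.prod_eq_zero (Finset.mem_univ k) (by simp), mul_zero]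

theorem le_norm_coeff_of_le_norm_eval {d : ℕ} {f : Polynomial ℂ} (hd : f.natDegree ≤ d) {c : ℝ}
    (hf : ∀ t : ℂ, 0 < t.im → c * t.im ^ d ≤ ‖f.eval t‖) : c ≤ ‖f.coeff d‖ := by
  have hlim : Filter.Tendsto (fun s : ℝ => ‖(f.reflect d).eval ((s : ℂ) * -Complex.I)‖)
      (nhdsWithin 0 (Set.Ioi 0)) (nhds ‖f.coeff d‖) := by
    have h0 : ‖f.coeff d‖ = ‖(f.reflect d).eval (((0 : ℝ) : ℂ) * -Complex.I)‖ := by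
      rw [Complex.ofReal_zero, zero_mul, ← Polynomial.coeff_zero_eq_eval_zero,
        Polynomial.coeff_reflect, Polynomial.revAt_le (Nat.zero_le _), Nat.sub_zero]
    rw [h0]
    refine (Continuous.tendsto ?_ 0).mono_left nhdsWithin_le_nhds
    fun_prop
  refine ge_of_tendsto hlim ?_
  filter_upwards [self_mem_nhdsWithin] with s (hs : 0 < s)
  have hs' : (s : ℂ) ≠ 0 := by exact_mod_cast hs.ne'
  set x : ℂ := Complex.I * (s : ℂ)⁻¹ with hx
  have hx0 : x ≠ 0 := mul_ne_zero Complex.I_ne_zero (inv_ne_zero hs')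
  let _ : Invertible x := invertibleOfNonzero hx0
  have hinv : ⅟x = (s : ℂ) * -Complex.I := by
    rw [invOf_eq_inv, hx, mul_inv, inv_inv, Complex.inv_I, mul_comm]
  have h1 := Polynomial.eval₂_reflect_mul_pow (RingHom.id ℂ) x d f hd
  rw [hinv] at h1
  simp only [Polynomial.eval₂_id] at h1
  have him : x.im = s⁻¹ := by
    rw [hx, ← Complex.ofReal_inv]; simp
  have hnx : ‖x‖ = s⁻¹ := by
    rw [hx]; simp [abs_of_pos hs]
  have h2 := hf x (by rw [him]; positivity)
  rw [← h1, norm_mul, norm_pow, him, hnx] at h2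
  exact le_of_mul_le_mul_right h2 (by positivity)

theorem le_norm_eval_derivative {d : ℕ} {f : Polynomial ℂ} (hd : f.natDegree ≤ d + 1) {c : ℝ}
    (hc : 0 < c) (hf : ∀ t : ℂ, 0 < t.im → c * t.im ^ (d + 1) ≤ ‖f.eval t‖) (t : ℂ)
    (ht : 0 < t.im) : c * t.im ^ d ≤ ‖f.derivative.eval t‖ := by
  have hlead := le_norm_coeff_of_le_norm_eval hd hf
  have hne : f.coeff (d + 1) ≠ 0 := by
    intro h; rw [h, norm_zero] at hlead; linarith
  have hdeg : f.natDegree = d + 1 := le_antisymm hd (Polynomial.le_natDegree_of_ne_zero hne)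
  have hf0 : ∀ t : ℂ, 0 < t.im → f.eval t ≠ 0 := fun t ht h => by
    have h' := hf t ht
    rw [h, norm_zero] at h'
    have : 0 < c * t.im ^ (d + 1) := by positivity
    linarith
  have hroots : f.rootSet ℂ ⊆ {w : ℂ | w.im ≤ 0} := by
    intro w hw
    by_contra! hw'
    rw [Polynomial.mem_rootSet, Polynomial.coe_aeval_eq_eval] at hw
    exact hf0 w (by simpa using hw') hw.2
  have hder : ∀ t : ℂ, 0 < t.im → f.derivative.eval t ≠ 0 := by
    intro t ht h
    have hne' : f.derivative ≠ 0 := by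
      intro h0
      have := Polynomial.derivative_eq_zero.mp h0
      omega
    have hmem : t ∈ f.derivative.rootSet ℂ := by
      rw [Polynomial.mem_rootSet, Polynomial.coe_aeval_eq_eval]; exact ⟨hne', h⟩
    have h1 := Polynomial.rootSet_derivative_subset_convexHull_rootSet
      (Polynomial.natDegree_pos_iff_degree_pos.mp (by omega)) hmem
    have h2 := convexHull_min hroots (convex_halfSpace_im_le 0) h1
    exact absurd ht (not_lt.mpr h2)
  have h3 := norm_coeff_mul_im_pow_le (d := d)
    ((Polynomial.natDegree_derivative_le f).trans (by omega)) hder t ht.le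
  refine le_trans ?_ h3
  gcongr
  rw [Polynomial.coeff_derivative, norm_mul]
  calc c ≤ ‖f.coeff (d + 1)‖ * 1 := by simpa using hlead
    _ ≤ _ := by
      gcongr
      have : ((d : ℂ) + 1) = ((d + 1 : ℝ) : ℂ) := by push_cast; rfl
      rw [this, Complex.norm_real, Real.norm_eq_abs, abs_of_pos (by positivity)]
      linarith [(Nat.cast_nonneg d : (0 : ℝ) ≤ d)]

theorem im_eval_derivative_mul_conj_nonpos {f : Polynomial ℂ}
    (hf : ∀ t : ℂ, 0 < t.im → f.eval t ≠ 0) (t : ℂ) (ht : 0 < t.im) :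
    (f.derivative.eval t * (starRingEnd ℂ) (f.eval t)).im ≤ 0 := by
  rw [(IsAlgClosed.splits f).eval_derivative_eq_eval_mul_sum (hf t ht), mul_right_comm,
    Complex.mul_conj, Complex.im_ofReal_mul]
  refine mul_nonpos_of_nonneg_of_nonpos (Complex.normSq_nonneg _) ?_
  have : ∀ s : Multiset ℂ, (∀ w ∈ s, w.im ≤ 0) →
      ((s.map fun z ↦ 1 / (t - z)).sum).im ≤ 0 := by
    intro s
    induction s using Multiset.induction_on with
    | empty => simp
    | cons a s ih =>
      intro h
      simp only [Multiset.map_cons, Multiset.sum_cons, Complex.add_im]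
      have h1 := ih fun w hw => h w (Multiset.mem_cons_of_mem hw)
      have h2 : (1 / (t - a)).im ≤ 0 := by
        rw [one_div, Complex.inv_im]
        apply div_nonpos_of_nonpos_of_nonneg _ (Complex.normSq_nonneg _)
        have := h a (Multiset.mem_cons_self a s)
        simp only [Complex.sub_im]; linarith
      linarith
  refine this _ fun w hw => ?_
  by_contra! h
  exact hf w h (Polynomial.isRoot_of_mem_roots hw)

theorem splits_of_forall_im_pos {f : Polynomial ℝ}
    (hf : ∀ t : ℂ, 0 < t.im → (f.map (algebraMap ℝ ℂ)).eval t ≠ 0) : f.Splits := by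
  refine Polynomial.Splits.of_splits_map_of_injective (algebraMap ℝ ℂ).injective
    (IsAlgClosed.splits _) fun a ha => ?_
  have hroot := Polynomial.isRoot_of_mem_roots ha
  have hconj : (f.map (algebraMap ℝ ℂ)).eval ((starRingEnd ℂ) a) = 0 := by
    rw [Polynomial.eval_map_algebraMap, Polynomial.aeval_conj, ← Polynomial.eval_map_algebraMap, hroot.eq_zero,
      map_zero]
  have him : a.im = 0 := by
    rcases lt_trichotomy a.im 0 with h | h | h
    · exact absurd hconj (hf _ (by simpa using h))
    · exact h
    · exact absurd hroot.eq_zero (hf _ h)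
  exact ⟨a.re, Complex.ext (by simp) (by simp [him])⟩

theorem mul_im_conj_pow_nonpos {H F : Polynomial ℝ} {x : ℝ} {M : ℕ}
    (him : ∀ t : ℂ, 0 < t.im → (Polynomial.aeval t H * (starRingEnd ℂ)
      (Polynomial.aeval t ((Polynomial.X - Polynomial.C x) ^ M * F))).im ≤ 0)
    (w : ℂ) (hw : 0 < w.im) :
    H.eval x * F.eval x * ((starRingEnd ℂ) w ^ M).im ≤ 0 := by
  have hlim : Filter.Tendsto (fun s : ℝ => (Polynomial.aeval ((x : ℂ) + s * w) H *
      (starRingEnd ℂ) (Polynomial.aeval ((x : ℂ) + s * w) F) * (starRingEnd ℂ) w ^ M).im)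
      (nhdsWithin 0 (Set.Ioi 0)) (nhds (H.eval x * F.eval x * ((starRingEnd ℂ) w ^ M).im)) := by
    have h0 : H.eval x * F.eval x * ((starRingEnd ℂ) w ^ M).im =
        (Polynomial.aeval ((x : ℂ) + (0 : ℝ) * w) H *
      (starRingEnd ℂ) (Polynomial.aeval ((x : ℂ) + (0 : ℝ) * w) F) * (starRingEnd ℂ) w ^ M).im := by
      have e : ∀ p : Polynomial ℝ, Polynomial.aeval (x : ℂ) p = ((p.eval x : ℝ) : ℂ) := fun p =>
        Polynomial.aeval_algebraMap_apply_eq_algebraMap_eval x p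
      rw [Complex.ofReal_zero, zero_mul, add_zero, e, e, Complex.conj_ofReal,
        ← Complex.ofReal_mul, Complex.im_ofReal_mul]
    rw [h0]
    refine (Continuous.tendsto ?_ 0).mono_left nhdsWithin_le_nhds
    refine Complex.continuous_im.comp ?_
    refine ((?_ : Continuous _).mul (Complex.continuous_conj.comp ?_)).mul continuous_const
    · exact (Polynomial.continuous_aeval H).comp (by fun_prop)
    · exact (Polynomial.continuous_aeval F).comp (by fun_prop)
  refine le_of_tendsto hlim ?_
  filter_upwards [self_mem_nhdsWithin] with s (hs : 0 < s)
  have h1 := him ((x : ℂ) + s * w) (by simp; positivity)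
  have h2 : Polynomial.aeval ((x : ℂ) + s * w) H * (starRingEnd ℂ)
      (Polynomial.aeval ((x : ℂ) + s * w) ((Polynomial.X - Polynomial.C x) ^ M * F)) =
      ((s ^ M : ℝ) : ℂ) * (Polynomial.aeval ((x : ℂ) + s * w) H *
      (starRingEnd ℂ) (Polynomial.aeval ((x : ℂ) + s * w) F) * (starRingEnd ℂ) w ^ M) := by
    simp only [map_mul, map_pow, map_sub, Polynomial.aeval_X, Polynomial.aeval_C,
      Complex.coe_algebraMap, add_sub_cancel_left, Complex.conj_ofReal, Complex.ofReal_pow]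
    ring
  rw [h2, Complex.im_ofReal_mul] at h1
  exact nonpos_of_mul_nonpos_right h1 (by positivity)

theorem mul_eval_nonneg_of_im_nonpos {H F : Polynomial ℝ} {x : ℝ}
    (him : ∀ t : ℂ, 0 < t.im → (Polynomial.aeval t H * (starRingEnd ℂ)
      (Polynomial.aeval t ((Polynomial.X - Polynomial.C x) * F))).im ≤ 0) :
    0 ≤ H.eval x * F.eval x := by
  have := mul_im_conj_pow_nonpos (M := 1) (by simpa using him) Complex.I (by simp)
  simp at this
  linarith

theorem mul_eval_eq_zero_of_im_nonpos {H F : Polynomial ℝ} {x : ℝ} {M : ℕ} (hM : 2 ≤ M)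
    (him : ∀ t : ℂ, 0 < t.im → (Polynomial.aeval t H * (starRingEnd ℂ)
      (Polynomial.aeval t ((Polynomial.X - Polynomial.C x) ^ M * F))).im ≤ 0) :
    H.eval x * F.eval x = 0 := by
  have hM' : (2 : ℝ) ≤ M := by exact_mod_cast hM
  have key : ∀ θ : ℝ, 0 < θ → θ < Real.pi * M → H.eval x * F.eval x * Real.sin (-θ) ≤ 0 := by
    intro θ h1 h2
    have h := mul_im_conj_pow_nonpos him (Complex.exp ((θ / M : ℝ) * Complex.I)) (by
      rw [Complex.exp_ofReal_mul_I_im]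
      apply Real.sin_pos_of_pos_of_lt_pi (by positivity)
      rwa [div_lt_iff₀ (by positivity)])
    rw [← Complex.exp_conj, ← Complex.exp_nat_mul] at h
    have e : (M : ℂ) * (starRingEnd ℂ) (((θ / M : ℝ) : ℂ) * Complex.I) = ((-θ : ℝ) : ℂ) * Complex.I := by
      have : (M : ℂ) ≠ 0 := by norm_cast; omega
      rw [map_mul, Complex.conj_ofReal, Complex.conj_I]
      push_cast
      field_simp
    rwa [e, Complex.exp_ofReal_mul_I_im] at h
  have h1 := key (Real.pi / 2) (by positivity) (by nlinarith [Real.pi_pos])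
  have h2 := key (Real.pi / 2 + Real.pi) (by positivity) (by nlinarith [Real.pi_pos])
  rw [Real.sin_neg, Real.sin_pi_div_two] at h1
  rw [Real.sin_neg, Real.sin_add_pi, Real.sin_pi_div_two] at h2
  linarith

theorem exists_partial_fraction {ι : Type*} [DecidableEq ι] (l : ι → ℝ) (s : Finset ι)
    (H : Polynomial ℝ) (hdeg : H.natDegree ≤ s.card)
    (him : ∀ t : ℂ, 0 < t.im → (Polynomial.aeval t H * (starRingEnd ℂ)
      (Polynomial.aeval t (∏ k ∈ s, (Polynomial.X - Polynomial.C (l k))))).im ≤ 0) :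
    ∃ (c : ℝ) (m : ι → ℝ), (∀ k, 0 ≤ m k) ∧
      H = Polynomial.C c * ∏ k ∈ s, (Polynomial.X - Polynomial.C (l k)) +
        ∑ k ∈ s, Polynomial.C (m k) * ∏ j ∈ s.erase k, (Polynomial.X - Polynomial.C (l j)) := by
  induction hs : s.card generalizing s H with
  | zero =>
    have : s = ∅ := Finset.card_eq_zero.mp hs
    subst this
    refine ⟨H.coeff 0, 0, fun _ => le_rfl, ?_⟩
    simpa using Polynomial.eq_C_of_natDegree_le_zero (by simpa using hdeg)
  | succ N ih =>
    by_cases hex : ∃ k ∈ s, H.eval (l k) = 0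
    · obtain ⟨k, hk, hHk⟩ := hex
      obtain ⟨H₁, rfl⟩ := Polynomial.dvd_iff_isRoot.mpr hHk
      have hcard : (s.erase k).card = N := by rw [Finset.card_erase_of_mem hk, hs]; rfl
      have hP := Finset.mul_prod_erase s (fun k => Polynomial.X - Polynomial.C (l k)) hk
      obtain ⟨c, m, hm, hH⟩ := ih (s.erase k) H₁ (by
        by_cases h0 : H₁ = 0
        · simp [h0]
        · rw [Polynomial.natDegree_mul (Polynomial.X_sub_C_ne_zero _) h0,
            Polynomial.natDegree_X_sub_C] at hdeg
          omega) (by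
        intro t ht
        have h := him t ht
        rw [← hP] at h
        simp only [map_mul] at h ⊢
        have hne : 0 < Complex.normSq (Polynomial.aeval t (Polynomial.X - Polynomial.C (l k))) := by
          rw [Complex.normSq_pos]
          intro h0
          have := congrArg Complex.im h0
          simp at this
          exact ht.ne' this
        rw [mul_mul_mul_comm, Complex.mul_conj, Complex.im_ofReal_mul] at h
        exact nonpos_of_mul_nonpos_right h hne) hcard
      refine ⟨c, Function.update m k 0, fun j => ?_, ?_⟩
      · by_cases h : j = k
        · simp [h]
        · simp [h, hm j]
      · rw [← Finset.add_sum_erase s _ hk, Function.update_self, ← hP]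
        conv_lhs => rw [hH]
        rw [mul_add, Finset.mul_sum]
        simp only [map_zero, zero_mul, zero_add]
        congr 1
        · ring
        · refine Finset.sum_congr rfl fun j hj => ?_
          have hjk : j ≠ k := Finset.ne_of_mem_erase hj
          rw [Function.update_of_ne hjk, Finset.erase_right_comm,
            ← Finset.mul_prod_erase (s.erase j) _ (Finset.mem_erase.mpr ⟨hjk.symm, hk⟩)]
          ring
    · push Not at hex
      have hinj : Set.InjOn l s := by
        intro a ha b hb hab
        by_contra hne
        set F := ∏ k ∈ s, (Polynomial.X - Polynomial.C (l k)) with hF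
        have hF0 : F ≠ 0 := Finset.prod_ne_zero_iff.mpr fun k _ => Polynomial.X_sub_C_ne_zero _
        obtain ⟨F₁, hF₁, hnd⟩ := Polynomial.exists_eq_pow_rootMultiplicity_mul_and_not_dvd F hF0 (l a)
        have hM : 2 ≤ F.rootMultiplicity (l a) := by
          rw [Polynomial.le_rootMultiplicity_iff hF0, hF, ← Finset.mul_prod_erase s _ ha,
            ← Finset.mul_prod_erase (s.erase a) _
              (Finset.mem_erase.mpr ⟨Ne.symm hne, hb⟩), ← hab, ← mul_assoc, ← sq]
          exact dvd_mul_right _ _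
        rw [hF₁] at him
        have h0 := mul_eval_eq_zero_of_im_nonpos hM him
        rcases mul_eq_zero.mp h0 with h | h
        · exact hex a ha h
        · exact hnd (Polynomial.dvd_iff_isRoot.mpr h)
      have hFk : ∀ k ∈ s, (∏ j ∈ s.erase k, (Polynomial.X - Polynomial.C (l j))).eval (l k) ≠ 0 := by
        intro k hk
        rw [Polynomial.eval_prod, Finset.prod_ne_zero_iff]
        intro j hj
        simp only [Polynomial.eval_sub, Polynomial.eval_X, Polynomial.eval_C, sub_ne_zero]
        intro h
        exact (Finset.ne_of_mem_erase hj) (hinj (Finset.mem_of_mem_erase hj) hk h.symm)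
      set m : ι → ℝ := fun k => if k ∈ s then
        H.eval (l k) / (∏ j ∈ s.erase k, (Polynomial.X - Polynomial.C (l j))).eval (l k) else 0 with hm
      refine ⟨H.coeff s.card, m, fun k => ?_, ?_⟩
      · simp only [hm]
        split_ifs with hk
        · rw [← mul_div_mul_right _ _ (hFk k hk)]
          refine div_nonneg (mul_eval_nonneg_of_im_nonpos ?_) (mul_self_nonneg _)
          rwa [Finset.mul_prod_erase s (fun k => Polynomial.X - Polynomial.C (l k)) hk]
        · exact le_rfl
      · rw [← sub_eq_zero]
        refine Polynomial.eq_zero_of_degree_lt_of_eval_index_eq_zero s hinj ?_ ?_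
        · rw [Polynomial.degree_lt_iff_coeff_zero]
          intro j hj
          have hmon : (∏ k ∈ s, (Polynomial.X - Polynomial.C (l k))).Monic :=
            Polynomial.monic_prod_of_monic _ _ fun k _ => Polynomial.monic_X_sub_C _
          have hnd : (∏ k ∈ s, (Polynomial.X - Polynomial.C (l k))).natDegree = s.card := by
            rw [Polynomial.natDegree_prod_of_monic _ _ fun k _ => Polynomial.monic_X_sub_C _]
            simp
          have hsum : (∑ k ∈ s, Polynomial.C (m k) *
              ∏ j ∈ s.erase k, (Polynomial.X - Polynomial.C (l j))).coeff j = 0 := by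
            rw [Polynomial.finsetSum_coeff]
            refine Finset.sum_eq_zero fun k hk => ?_
            rw [Polynomial.coeff_C_mul, Polynomial.coeff_eq_zero_of_natDegree_lt, mul_zero]
            rw [Polynomial.natDegree_prod_of_monic _ _ fun k _ => Polynomial.monic_X_sub_C _]
            simp only [Polynomial.natDegree_X_sub_C, Finset.sum_const, smul_eq_mul, mul_one]
            rw [Finset.card_erase_of_mem hk]
            omega
          rw [Polynomial.coeff_sub, Polynomial.coeff_add, hsum, add_zero, Polynomial.coeff_C_mul]
          rcases hj.eq_or_lt with h | h
          · have : (∏ k ∈ s, (Polynomial.X - Polynomial.C (l k))).coeff j = 1 := by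
              rw [← h, ← hnd]; exact hmon
            rw [this, ← h]; ring
          · rw [Polynomial.coeff_eq_zero_of_natDegree_lt (p := H) (by omega),
              Polynomial.coeff_eq_zero_of_natDegree_lt (p := ∏ k ∈ s, _) (by omega)]
            ring
        · intro k hk
          have h1 : (∏ k ∈ s, (Polynomial.X - Polynomial.C (l k))).eval (l k) = 0 := by
            rw [Polynomial.eval_prod]
            exact Finset.prod_eq_zero hk (by simp)
          rw [Polynomial.eval_sub, Polynomial.eval_add, Polynomial.eval_mul, h1,
            Polynomial.eval_finsetSum, Finset.sum_eq_single_of_mem k hk]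
          · simp only [hm, hk, if_true, Polynomial.eval_mul, Polynomial.eval_C]
            rw [div_mul_cancel₀ _ (hFk k hk)]; ring
          · intro j hj hjk
            rw [Polynomial.eval_mul, Polynomial.eval_prod,
              Finset.prod_eq_zero (Finset.mem_erase.mpr ⟨hjk.symm, hk⟩) (by simp), mul_zero]

section Leibniz

variable {R A ι : Type*} [CommRing R] [CommRing A] [Algebra R A] (D : Derivation R A A)

theorem Derivation.iterate_succ_mul_of_sq_eq_zero {h : A} (hh : D (D h) = 0) (H : A) (m : ℕ) :
    D^[m + 1] (h * H) = h * D^[m + 1] H + (m + 1 : ℕ) * (D h * D^[m] H) := by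
  induction m with
  | zero => simp [D.leibniz]; ring
  | succ m ih =>
    have e1 : D (D^[m + 1] H) = D^[m + 1 + 1] H := (Function.iterate_succ_apply' D _ _).symm
    have e2 : D (D^[m] H) = D^[m + 1] H := (Function.iterate_succ_apply' D _ _).symm
    rw [Function.iterate_succ_apply', ih, map_add, D.leibniz, D.leibniz, D.leibniz, D.map_natCast,
      hh, e1, e2]
    simp only [smul_eq_mul]
    push_cast
    ring

theorem Derivation.iterate_prod_of_sq_eq_zero [DecidableEq ι] (s : Finset ι) (h : ι → A)
    (hh : ∀ k ∈ s, D (D (h k)) = 0) :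
    D^[s.card + 1] (∏ k ∈ s, h k) = 0 ∧
    D^[s.card] (∏ k ∈ s, h k) = (s.card.factorial : ℕ) * ∏ k ∈ s, D (h k) ∧
    (s.Nonempty → D^[s.card - 1] (∏ k ∈ s, h k) =
      ((s.card - 1).factorial : ℕ) * ∑ j ∈ s, h j * ∏ k ∈ s.erase j, D (h k)) := by
  induction s using Finset.induction_on with
  | empty => simp
  | insert a s ha ih =>
    obtain ⟨h1, h2, h3⟩ := ih fun k hk => hh k (Finset.mem_insert_of_mem hk)
    have haa := hh a (Finset.mem_insert_self a s)
    rw [Finset.card_insert_of_notMem ha, Finset.prod_insert ha, Finset.prod_insert ha]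
    refine ⟨?_, ?_, fun _ => ?_⟩
    · rw [D.iterate_succ_mul_of_sq_eq_zero haa, h1, Function.iterate_succ_apply', h1]
      simp
    · rw [D.iterate_succ_mul_of_sq_eq_zero haa, h1, h2, Nat.factorial_succ]
      push_cast
      ring
    · rw [Nat.add_sub_cancel, Finset.sum_insert ha, Finset.erase_insert ha]
      rcases s.eq_empty_or_nonempty with rfl | hne
      · simp
      · have hsum : ∑ j ∈ s, h j * ∏ k ∈ (insert a s).erase j, D (h k) =
            D (h a) * ∑ j ∈ s, h j * ∏ k ∈ s.erase j, D (h k) := by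
          rw [Finset.mul_sum]
          refine Finset.sum_congr rfl fun j hj => ?_
          have hja : a ≠ j := fun h => ha (h ▸ hj)
          rw [Finset.erase_insert_of_ne hja, Finset.prod_insert (by simp [ha])]
          ring
        obtain ⟨c, hc⟩ : ∃ c, s.card = c + 1 := ⟨s.card - 1, by
          have := Finset.card_pos.mpr hne; omega⟩
        have h3' := h3 hne
        rw [hc] at h2 h3' ⊢
        rw [Nat.add_sub_cancel] at h3'
        rw [D.iterate_succ_mul_of_sq_eq_zero haa, h2, h3', hsum, Nat.factorial_succ]
        push_cast
        ring

end Leibniz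

theorem iterate_derivative_prod_X_sub_C {ι : Type*} [DecidableEq ι] (s : Finset ι) (l : ι → ℝ) :
    (∀ t : ℝ, (Polynomial.derivative^[s.card] (∏ k ∈ s, (Polynomial.X - Polynomial.C (l k)))).eval t =
      s.card.factorial) ∧
    (s.Nonempty → ∀ t : ℝ, (Polynomial.derivative^[s.card - 1]
      (∏ k ∈ s, (Polynomial.X - Polynomial.C (l k)))).eval t =
      (s.card - 1).factorial * ∑ k ∈ s, (t - l k)) := by
  obtain ⟨-, h2, h3⟩ := Derivation.iterate_prod_of_sq_eq_zero (Polynomial.derivative' (R := ℝ)) s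
    (fun k => (Polynomial.X - Polynomial.C (l k) : Polynomial ℝ)) (fun k _ => by simp)
  have he : ⇑(Polynomial.derivative' (R := ℝ)) = ⇑(Polynomial.derivative (R := ℝ)) := rfl
  rw [he] at h2 h3
  refine ⟨fun t => ?_, fun hs t => ?_⟩
  · have := congrArg (Polynomial.eval t) h2
    simpa [he] using this
  · have := congrArg (Polynomial.eval t) (h3 hs)
    simpa [he, Polynomial.eval_finsetSum] using this

theorem natDegree_le_of_iterate_derivative_eq_zero {K : Type*} [Field K] [CharZero K]
    {f : Polynomial K} {d : ℕ} (h : Polynomial.derivative^[d + 1] f = 0) : f.natDegree ≤ d := by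
  induction d generalizing f with
  | zero => exact (Polynomial.derivative_eq_zero.mp (by simpa using h)).le
  | succ d ih =>
    rw [Function.iterate_succ_apply] at h
    have h1 := ih h
    by_contra! hlt
    have := Polynomial.degree_derivative (p := f) (by omega)
    have h2 := Polynomial.natDegree_eq_of_degree_eq_some this
    omega

theorem coeff_eq_of_iterate_derivative {K : Type*} [Field K] {f : Polynomial K} {d : ℕ} (t : K)
    (h : f.natDegree ≤ d) :
    (Polynomial.derivative^[d] f).eval t = (d.factorial : K) * f.coeff d := by
  have h1 : (Polynomial.derivative^[d] f).natDegree ≤ 0 := by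
    have := Polynomial.natDegree_iterate_derivative f d
    omega
  rw [Polynomial.eq_C_of_natDegree_le_zero h1, Polynomial.eval_C, Polynomial.coeff_iterate_derivative]
  simp [Nat.descFactorial_self]

theorem MvPolynomial.pderiv_comm {σ R : Type*} [CommRing R] (i j : σ) (p : MvPolynomial σ R) :
    MvPolynomial.pderiv i (MvPolynomial.pderiv j p) =
      MvPolynomial.pderiv j (MvPolynomial.pderiv i p) := by
  have h : ⁅MvPolynomial.pderiv (R := R) i, MvPolynomial.pderiv (R := R) j⁆ = 0 := by
    classical
    refine MvPolynomial.derivation_ext fun k => ?_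
    rw [Derivation.commutator_apply, MvPolynomial.pderiv_X, MvPolynomial.pderiv_X]
    simp only [Pi.single_apply]
    split_ifs <;> simp
  have := congrArg (fun D => D p) h
  rw [Derivation.commutator_apply] at this
  simpa [sub_eq_zero] using this

theorem MvPolynomial.iterate_pderiv_comm {σ R : Type*} [CommRing R] (i j : σ) (a b : ℕ)
    (p : MvPolynomial σ R) :
    (MvPolynomial.pderiv i)^[a] ((MvPolynomial.pderiv j)^[b] p) =
      (MvPolynomial.pderiv j)^[b] ((MvPolynomial.pderiv i)^[a] p) :=
  (Function.Commute.iterate_iterate (fun q => MvPolynomial.pderiv_comm i j q) a b) p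

section Slice

variable {n : ℕ} {K : Type*} [CommRing K] [Algebra ℝ K]

/-- The univariate polynomial obtained from `p` by fixing all variables but the `i`-th one. -/
noncomputable def slice (i : Fin n) (z : Fin n → K) (p : MvPolynomial (Fin n) ℝ) : Polynomial K :=
  MvPolynomial.aeval (Function.update (fun j => Polynomial.C (z j)) i Polynomial.X) p

theorem eval_slice (i : Fin n) (z : Fin n → K) (p : MvPolynomial (Fin n) ℝ) (t : K) :
    (slice i z p).eval t = MvPolynomial.aeval (Function.update z i t) p := by
  unfold slice
  rw [← Polynomial.coe_evalRingHom, MvPolynomial.aeval_def, MvPolynomial.aeval_def,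
    MvPolynomial.hom_eval₂]
  congr 1
  · ext x; simp
  · funext j
    by_cases h : j = i
    · subst h; simp
    · simp [h]

theorem derivative_slice (i : Fin n) (z : Fin n → K) (p : MvPolynomial (Fin n) ℝ) :
    Polynomial.derivative (slice i z p) = slice i z (MvPolynomial.pderiv i p) := by
  induction p using MvPolynomial.induction_on with
  | C a => simp [slice, Polynomial.algebraMap_apply]
  | add p q hp hq => simp only [slice, map_add] at *; rw [hp, hq]
  | mul_X p j hp =>
    simp only [slice, map_mul, MvPolynomial.aeval_X, Polynomial.derivative_mul, Derivation.leibniz,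
      smul_eq_mul, map_add] at *
    rw [hp, MvPolynomial.pderiv_X]
    by_cases h : j = i
    · subst h; simp; ring
    · simp [h]; ring

theorem iterate_derivative_slice (i : Fin n) (z : Fin n → K) (p : MvPolynomial (Fin n) ℝ) (k : ℕ) :
    Polynomial.derivative^[k] (slice i z p) = slice i z ((MvPolynomial.pderiv i)^[k] p) := by
  induction k with
  | zero => rfl
  | succ k ih => rw [Function.iterate_succ_apply', ih, derivative_slice,
      Function.iterate_succ_apply']

theorem map_slice (i : Fin n) (x : Fin n → ℝ) (p : MvPolynomial (Fin n) ℝ) :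
    (slice i x p).map (algebraMap ℝ ℂ) = slice i (fun j => (x j : ℂ)) p := by
  unfold slice
  rw [← Polynomial.coe_mapRingHom, MvPolynomial.aeval_def, MvPolynomial.aeval_def,
    MvPolynomial.hom_eval₂]
  congr 1
  · ext x; simp [Polynomial.algebraMap_apply]
  · funext j
    by_cases h : j = i
    · subst h; simp
    · simp [h]

end Slice

section IteratedPartials

variable {n : ℕ}

/-- Differentiate `k` times with respect to every variable indexed by `S`. -/
noncomputable def iterPderivs (k : ℕ) (S : Finset (Fin n)) (p : MvPolynomial (Fin n) ℝ) :
    MvPolynomial (Fin n) ℝ :=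
  S.toList.foldr (fun i q => (MvPolynomial.pderiv i)^[k] q) p

theorem iterPderivs_one (S : Finset (Fin n)) (p : MvPolynomial (Fin n) ℝ) :
    iterPderivs 1 S p = pderivs S p := rfl

@[simp]
theorem iterPderivs_empty (k : ℕ) (p : MvPolynomial (Fin n) ℝ) : iterPderivs k ∅ p = p := by
  simp [iterPderivs]

theorem iterPderivs_insert (k : ℕ) {i : Fin n} {S : Finset (Fin n)} (hi : i ∉ S)
    (p : MvPolynomial (Fin n) ℝ) :
    iterPderivs k (insert i S) p = (MvPolynomial.pderiv i)^[k] (iterPderivs k S p) := by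
  unfold iterPderivs
  rw [(Finset.toList_insert hi).foldr_eq' (f := fun i q => (MvPolynomial.pderiv i)^[k] q)
    (fun x _ y _ z => MvPolynomial.iterate_pderiv_comm _ _ _ _ _), List.foldr_cons]

theorem iterate_pderiv_iterPderivs (m k : ℕ) (i : Fin n) (S : Finset (Fin n))
    (p : MvPolynomial (Fin n) ℝ) :
    (MvPolynomial.pderiv i)^[m] (iterPderivs k S p) =
      iterPderivs k S ((MvPolynomial.pderiv i)^[m] p) := by
  induction S using Finset.induction_on with
  | empty => simp
  | insert j S hj ih =>
    rw [iterPderivs_insert k hj, iterPderivs_insert k hj, MvPolynomial.iterate_pderiv_comm, ih]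

end IteratedPartials

/-- `p` has degree at most `d i` in the `i`-th variable and, on the product of the upper half
planes, is bounded below by a multiple of `∏ i, (z i).im ^ d i`. -/
structure StableOfDegree {n : ℕ} (p : MvPolynomial (Fin n) ℝ) (d : Fin n → ℕ) : Prop where
  iterate_pderiv_eq_zero : ∀ i, (MvPolynomial.pderiv i)^[d i + 1] p = 0
  exists_bound : ∃ c : ℝ, 0 < c ∧ ∀ z : Fin n → ℂ, (∀ i, 0 < (z i).im) →
    c * ∏ i, (z i).im ^ d i ≤ ‖MvPolynomial.aeval z p‖

theorem prod_update_im_pow {n : ℕ} (i : Fin n) (z : Fin n → ℂ) (t : ℂ) (d : Fin n → ℕ) :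
    ∏ j, (Function.update z i t j).im ^ d j =
      t.im ^ d i * ∏ j ∈ Finset.univ.erase i, (z j).im ^ d j := by
  rw [← Finset.mul_prod_erase _ _ (Finset.mem_univ i), Function.update_self]
  congr 1
  refine Finset.prod_congr rfl fun j hj => ?_
  rw [Function.update_of_ne (Finset.ne_of_mem_erase hj)]

theorem prod_im_pow_update {n : ℕ} (i : Fin n) (z : Fin n → ℂ) (d : Fin n → ℕ) (k : ℕ) :
    ∏ j, (z j).im ^ Function.update d i k j =
      (z i).im ^ k * ∏ j ∈ Finset.univ.erase i, (z j).im ^ d j := by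
  rw [← Finset.mul_prod_erase _ _ (Finset.mem_univ i), Function.update_self]
  congr 1
  refine Finset.prod_congr rfl fun j hj => ?_
  rw [Function.update_of_ne (Finset.ne_of_mem_erase hj)]

theorem continuous_aeval_add_I {n : ℕ} (z : Fin n → ℂ) (p : MvPolynomial (Fin n) ℝ) :
    Continuous fun ε : ℝ => MvPolynomial.aeval (fun j => z j + ε * Complex.I) p := by
  simp only [MvPolynomial.aeval_def, MvPolynomial.eval₂_eq]
  fun_prop

theorem forall_of_forall_im_pos {n : ℕ} {f h : (Fin n → ℂ) → ℝ}
    (hf : ∀ z : Fin n → ℂ, Continuous fun ε : ℝ => f fun j : Fin n => z j + ε * Complex.I)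
    (hh : ∀ z : Fin n → ℂ, Continuous fun ε : ℝ => h fun j : Fin n => z j + ε * Complex.I)
    (H : ∀ z : Fin n → ℂ, (∀ i, 0 < (z i).im) → f z ≤ h z) (z : Fin n → ℂ)
    (hz : ∀ i, 0 ≤ (z i).im) : f z ≤ h z := by
  have h1 := ((hf z).tendsto 0).mono_left (nhdsWithin_le_nhds (s := Set.Ioi 0))
  have h2 := ((hh z).tendsto 0).mono_left (nhdsWithin_le_nhds (s := Set.Ioi 0))
  have h3 := le_of_tendsto_of_tendsto h1 h2 (by
    filter_upwards [self_mem_nhdsWithin] with ε hε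
    refine H _ fun i => ?_
    have : (0 : ℝ) < ε := hε
    have := hz i
    simp; linarith)
  simpa using h3

namespace StableOfDegree

variable {n : ℕ} {p : MvPolynomial (Fin n) ℝ} {d : Fin n → ℕ}

theorem natDegree_slice_le {K : Type*} [Field K] [CharZero K] [Algebra ℝ K]
    (h : StableOfDegree p d) (i : Fin n) (z : Fin n → K) : (slice i z p).natDegree ≤ d i := by
  apply natDegree_le_of_iterate_derivative_eq_zero
  rw [iterate_derivative_slice, h.iterate_pderiv_eq_zero]
  simp [slice]

theorem exists_slice_bound (h : StableOfDegree p d) (i : Fin n) {z : Fin n → ℂ}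
    (hz : ∀ i, 0 < (z i).im) :
    ∃ c : ℝ, 0 < c ∧ ∀ t : ℂ, 0 < t.im → c * t.im ^ d i ≤ ‖(slice i z p).eval t‖ := by
  obtain ⟨c, hc, hb⟩ := h.exists_bound
  refine ⟨c * ∏ j ∈ Finset.univ.erase i, (z j).im ^ d j,
    mul_pos hc (Finset.prod_pos fun j _ => pow_pos (hz j) _), fun t ht => ?_⟩
  have := hb (Function.update z i t) (fun j => by
    by_cases hj : j = i
    · subst hj; simpa using ht
    · simpa [hj] using hz j)
  rw [eval_slice]
  refine le_trans (le_of_eq ?_) this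
  rw [prod_update_im_pow]
  ring

theorem eval_slice_ne_zero (h : StableOfDegree p d) (i : Fin n) {z : Fin n → ℂ}
    (hz : ∀ i, 0 < (z i).im) (t : ℂ) (ht : 0 < t.im) : (slice i z p).eval t ≠ 0 := by
  obtain ⟨c, hc, hb⟩ := h.exists_slice_bound i hz
  rw [← norm_pos_iff]
  exact (by positivity : 0 < c * t.im ^ d i).trans_le (hb t ht)

theorem pderiv (h : StableOfDegree p d) {i : Fin n} {k : ℕ} (hd : d i = k + 1) :
    StableOfDegree (MvPolynomial.pderiv i p) (Function.update d i k) := by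
  refine ⟨fun j => ?_, ?_⟩
  · by_cases hj : j = i
    · subst hj
      have := h.iterate_pderiv_eq_zero j
      rw [hd, Function.iterate_succ_apply] at this
      simpa using this
    · have := MvPolynomial.iterate_pderiv_comm j i (d j + 1) 1 p
      rw [h.iterate_pderiv_eq_zero] at this
      rw [Function.iterate_one, map_zero] at this
      rw [Function.update_of_ne hj]
      exact this
  · obtain ⟨c, hc, hb⟩ := h.exists_bound
    refine ⟨c, hc, fun z hz => ?_⟩
    have := le_norm_eval_derivative (f := slice i z p) (d := k)
      (c := c * ∏ j ∈ Finset.univ.erase i, (z j).im ^ d j)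
      ((h.natDegree_slice_le i z).trans hd.le)
      (mul_pos hc (Finset.prod_pos fun j _ => pow_pos (hz j) _)) (fun t ht => ?_) (z i) (hz i)
    · rw [derivative_slice, eval_slice, Function.update_eq_self] at this
      refine le_trans (le_of_eq ?_) this
      rw [prod_im_pow_update]
      ring
    · have := hb (Function.update z i t) (fun j => by
        by_cases hj : j = i
        · subst hj; simpa using ht
        · simpa [hj] using hz j)
      rw [eval_slice]
      refine le_trans (le_of_eq ?_) this
      rw [prod_update_im_pow, hd]
      ring

theorem iterate_pderiv (h : StableOfDegree p d) {i : Fin n} {k m : ℕ} (hd : d i = m + k) :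
    StableOfDegree ((MvPolynomial.pderiv i)^[k] p) (Function.update d i m) := by
  induction k generalizing m with
  | zero =>
    have : Function.update d i m = d := by rw [← Function.update_eq_self i d, hd]; simp
    simpa [this] using h
  | succ k ih =>
    have := (ih (m := m + 1) (by omega)).pderiv (i := i) (k := m) (by simp)
    rw [Function.iterate_succ_apply']
    simpa using this

theorem iterPderivs (h : StableOfDegree p d) {k : ℕ} {S : Finset (Fin n)}
    (hd : ∀ i ∈ S, k ≤ d i) :
    StableOfDegree (iterPderivs k S p) fun i => if i ∈ S then d i - k else d i := by
  induction S using Finset.induction_on with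
  | empty => simpa using h
  | insert i S hi ih =>
    have h1 := ih fun j hj => hd j (Finset.mem_insert_of_mem hj)
    have h2 := hd i (Finset.mem_insert_self i S)
    have h3 := h1.iterate_pderiv (i := i) (k := k) (m := d i - k) (by simp [hi]; omega)
    rw [iterPderivs_insert k hi]
    convert h3 using 1
    funext j
    by_cases hj : j = i
    · subst hj; simp
    · simp [hj]

theorem im_pderiv_mul_conj_nonpos (h : StableOfDegree p d) (i : Fin n) {z : Fin n → ℂ}
    (hz : ∀ i, 0 ≤ (z i).im) :
    (MvPolynomial.aeval z (MvPolynomial.pderiv i p) *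
      (starRingEnd ℂ) (MvPolynomial.aeval z p)).im ≤ 0 := by
  refine forall_of_forall_im_pos (h := fun _ => 0) (f := fun z =>
    (MvPolynomial.aeval z (MvPolynomial.pderiv i p) *
      (starRingEnd ℂ) (MvPolynomial.aeval z p)).im)
    (fun z => ?_) (fun z => continuous_const) (fun z hz => ?_) z hz
  · exact Complex.continuous_im.comp ((continuous_aeval_add_I _ _).mul
      (Complex.continuous_conj.comp (continuous_aeval_add_I _ _)))
  · have := im_eval_derivative_mul_conj_nonpos (f := slice i z p) (h.eval_slice_ne_zero i hz)
      (z i) (hz i)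
    simpa [derivative_slice, eval_slice] using this

theorem eval_iterate_pderiv {K : Type*} [Field K] [CharZero K] [Algebra ℝ K]
    (h : StableOfDegree p d) (i : Fin n) (z : Fin n → K) (t : K) :
    MvPolynomial.aeval (Function.update z i t) ((MvPolynomial.pderiv i)^[d i] p) =
      ((d i).factorial : K) * (slice i z p).coeff (d i) := by
  rw [← coeff_eq_of_iterate_derivative t (h.natDegree_slice_le i z), iterate_derivative_slice,
    eval_slice]

theorem norm_iterate_pderiv_mul_le (h : StableOfDegree p d) (i : Fin n) {z : Fin n → ℂ}
    (hz : ∀ i, 0 ≤ (z i).im) :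
    ‖MvPolynomial.aeval z ((MvPolynomial.pderiv i)^[d i] p)‖ * (z i).im ^ d i ≤
      (d i).factorial * ‖MvPolynomial.aeval z p‖ := by
  refine forall_of_forall_im_pos (h := fun z => (d i).factorial * ‖MvPolynomial.aeval z p‖)
    (f := fun z => ‖MvPolynomial.aeval z ((MvPolynomial.pderiv i)^[d i] p)‖ * (z i).im ^ d i)
    (fun z => ?_) (fun z => ?_) (fun z hz => ?_) z hz
  · refine (continuous_norm.comp (continuous_aeval_add_I _ _)).mul ?_
    fun_prop
  · exact continuous_const.mul (continuous_norm.comp (continuous_aeval_add_I _ _))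
  · have h1 := norm_coeff_mul_im_pow_le (h.natDegree_slice_le i z) (h.eval_slice_ne_zero i hz)
      (z i) (hz i).le
    have h2 := h.eval_iterate_pderiv i z (z i)
    rw [Function.update_eq_self] at h2
    rw [h2, norm_mul, Complex.norm_natCast, mul_assoc]
    rw [eval_slice, Function.update_eq_self] at h1
    gcongr

theorem splits_slice (h : StableOfDegree p d) (i : Fin n) {x : Fin n → ℝ}
    (hx : MvPolynomial.aeval x ((MvPolynomial.pderiv i)^[d i] p) ≠ 0) :
    (slice i x p).Splits ∧ (slice i x p).natDegree = d i ∧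
      (d i).factorial * (slice i x p).leadingCoeff =
        MvPolynomial.aeval x ((MvPolynomial.pderiv i)^[d i] p) := by
  have h1 := h.eval_iterate_pderiv i x (x i)
  rw [Function.update_eq_self] at h1
  have hc : (slice i x p).coeff (d i) ≠ 0 := fun h0 => hx (by rw [h1, h0, mul_zero])
  have hdeg : (slice i x p).natDegree = d i :=
    le_antisymm (h.natDegree_slice_le i x) (Polynomial.le_natDegree_of_ne_zero hc)
  refine ⟨splits_of_forall_im_pos fun t ht => ?_, hdeg, by rw [h1, Polynomial.leadingCoeff, hdeg]⟩
  have h2 := h.norm_iterate_pderiv_mul_le i (z := Function.update (fun j => (x j : ℂ)) i t)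
    (fun j => by
      by_cases hj : j = i
      · subst hj; simpa using ht.le
      · simp [hj])
  have h3 : (slice i (fun j => (x j : ℂ)) p).coeff (d i) ≠ 0 := by
    rw [← map_slice, Polynomial.coeff_map]
    simpa using hc
  rw [h.eval_iterate_pderiv, Function.update_self] at h2
  rw [map_slice, eval_slice, ← norm_pos_iff]
  have h4 : 0 < ‖((d i).factorial : ℂ) * (slice i (fun j => (x j : ℂ)) p).coeff (d i)‖ *
      t.im ^ d i := by
    have : ((d i).factorial : ℂ) ≠ 0 := by exact_mod_cast (d i).factorial_ne_zero
    exact mul_pos (norm_pos_iff.mpr (mul_ne_zero this h3)) (pow_pos ht _)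
  exact pos_of_mul_pos_right (h4.trans_le h2) (by positivity)

end StableOfDegree

section MultiAffineForm

variable {n : ℕ}

theorem expOf_apply (A : Finset (Fin n)) (i : Fin n) : expOf A i = if i ∈ A then 1 else 0 := by
  classical
  simp [expOf, Finsupp.finsetSum_apply, Finsupp.single_apply]

theorem expOf_injective : Function.Injective (expOf : Finset (Fin n) → Fin n →₀ ℕ) := by
  intro A B h
  ext i
  have := DFunLike.congr_fun h i
  rw [expOf_apply, expOf_apply] at this
  by_cases hA : i ∈ A <;> by_cases hB : i ∈ B <;> simp_all

/-- The multi-affine polynomial with prescribed coefficients. -/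
noncomputable def multiAffineOf (c : Finset (Fin n) → ℝ) : MvPolynomial (Fin n) ℝ :=
  ∑ A, MvPolynomial.C (c A) * ∏ i ∈ A, MvPolynomial.X i

theorem prod_X_eq_monomial (A : Finset (Fin n)) :
    ∏ i ∈ A, MvPolynomial.X (R := ℝ) i = MvPolynomial.monomial (expOf A) 1 := by
  rw [expOf, MvPolynomial.monomial_sum_one]
  rfl

theorem MultiAffine.eq_multiAffineOf {g : MvPolynomial (Fin n) ℝ} (hg : MultiAffine g) :
    g = multiAffineOf fun A => MvPolynomial.coeff (expOf A) g := by
  classical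
  ext m
  simp only [multiAffineOf, MvPolynomial.coeff_sum, prod_X_eq_monomial, MvPolynomial.coeff_C_mul,
    MvPolynomial.coeff_monomial]
  by_cases hm : ∃ A, expOf A = m
  · obtain ⟨A, rfl⟩ := hm
    simp [expOf_injective.eq_iff]
  · have h0 : MvPolynomial.coeff m g = 0 := by
      by_contra hne
      refine hm ⟨m.support, Finsupp.ext fun i => ?_⟩
      have h1 : m i ≤ 1 :=
        (MvPolynomial.degreeOf_le_iff.mp (hg i) m (MvPolynomial.mem_support_iff.mpr hne))
      rw [expOf_apply]
      simp only [Finsupp.mem_support_iff]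
      split_ifs with h <;> omega
    rw [h0, Finset.sum_eq_zero]
    intro A _
    rw [if_neg fun h => hm ⟨A, h⟩, mul_zero]

theorem multiAffineOf_eq (i : Fin n) (c : Finset (Fin n) → ℝ) :
    multiAffineOf c =
      MvPolynomial.X i * multiAffineOf (fun A => if i ∈ A then 0 else c (insert i A)) +
        multiAffineOf fun A => if i ∈ A then 0 else c A := by
  unfold multiAffineOf
  rw [← Finset.sum_filter_add_sum_filter_not Finset.univ (fun A => i ∈ A), Finset.mul_sum]
  congr 1
  · rw [← Finset.sum_filter_add_sum_filter_not Finset.univ (fun A => i ∈ A)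
      (fun A => MvPolynomial.X i * (MvPolynomial.C (if i ∈ A then 0 else c (insert i A)) *
        ∏ i ∈ A, MvPolynomial.X i)),
      Finset.sum_eq_zero (s := Finset.univ.filter fun A => i ∈ A) (f := fun A =>
        MvPolynomial.X i * (MvPolynomial.C (if i ∈ A then 0 else c (insert i A)) *
        ∏ i ∈ A, MvPolynomial.X i)), zero_add]
    · refine Finset.sum_nbij' (fun A => A.erase i) (fun A => insert i A) ?_ ?_ ?_ ?_ ?_
      · intro A; simp
      · intro A; simp
      · intro A hA; exact Finset.insert_erase (by simpa using hA)
      · intro A hA; exact Finset.erase_insert (by simpa using hA)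
      · intro A hA
        have hA : i ∈ A := by simpa using hA
        rw [if_neg (Finset.notMem_erase i A), Finset.insert_erase hA,
          ← Finset.mul_prod_erase A _ hA]
        ring
    · intro A hA
      rw [if_pos (by simpa using hA)]
      simp
  · rw [Finset.sum_filter]
    refine Finset.sum_congr rfl fun A _ => ?_
    split_ifs <;> simp_all

theorem pderiv_multiAffineOf_eq_zero (i : Fin n) {c : Finset (Fin n) → ℝ}
    (hc : ∀ A, i ∈ A → c A = 0) : MvPolynomial.pderiv i (multiAffineOf c) = 0 := by
  rw [multiAffineOf, map_sum]
  refine Finset.sum_eq_zero fun A _ => ?_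
  by_cases hA : i ∈ A
  · simp [hc A hA]
  · apply MvPolynomial.pderiv_eq_zero_of_notMem_vars
    intro h
    rw [prod_X_eq_monomial, MvPolynomial.C_mul_monomial] at h
    obtain ⟨m, hm, hi⟩ := (MvPolynomial.mem_vars_iff_mem_support i).mp h
    have := Finset.mem_singleton.mp (MvPolynomial.support_monomial_subset hm)
    rw [this, Finsupp.mem_support_iff, expOf_apply, if_neg hA] at hi
    exact hi rfl

theorem pderiv_multiAffineOf (i : Fin n) (c : Finset (Fin n) → ℝ) :
    MvPolynomial.pderiv i (multiAffineOf c) =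
      multiAffineOf fun A => if i ∈ A then 0 else c (insert i A) := by
  rw [multiAffineOf_eq i c, map_add, Derivation.leibniz,
    pderiv_multiAffineOf_eq_zero i (c := fun A => if i ∈ A then 0 else c (insert i A))
      (fun A hA => if_pos hA),
    pderiv_multiAffineOf_eq_zero i (c := fun A => if i ∈ A then 0 else c A)
      (fun A hA => if_pos hA)]
  simp

theorem pderivs_multiAffineOf (S : Finset (Fin n)) (c : Finset (Fin n) → ℝ) :
    pderivs S (multiAffineOf c) =
      multiAffineOf fun A => if Disjoint A S then c (A ∪ S) else 0 := by
  rw [← iterPderivs_one]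
  induction S using Finset.induction_on with
  | empty => simp
  | insert i S hi ih =>
    rw [iterPderivs_insert 1 hi, ih, Function.iterate_one, pderiv_multiAffineOf]
    congr 1
    funext A
    by_cases hA : i ∈ A
    · rw [if_pos hA, if_neg]
      simp [hA]
    · rw [if_neg hA]
      simp [hA, hi]

theorem natDegree_diagPoly_multiAffineOf {c : Finset (Fin n) → ℝ} {U : Finset (Fin n)}
    (hc : ∀ A, c A ≠ 0 → A ⊆ U) :
    (diagPoly (multiAffineOf c)).natDegree ≤ U.card ∧
      (diagPoly (multiAffineOf c)).coeff U.card = c U := by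
  have h : diagPoly (multiAffineOf c) = ∑ A, Polynomial.C (c A) * Polynomial.X ^ A.card := by
    simp [diagPoly, multiAffineOf, map_sum]
  rw [h]
  constructor
  · refine Polynomial.natDegree_sum_le_of_forall_le _ _ fun A _ => ?_
    by_cases hA : c A = 0
    · simp [hA]
    · exact (Polynomial.natDegree_C_mul_X_pow_le _ _).trans (Finset.card_le_card (hc A hA))
  · rw [Polynomial.finsetSum_coeff, Finset.sum_eq_single U]
    · simp
    · intro A _ hAU
      by_cases hA : c A = 0
      · simp [hA]
      · rw [Polynomial.coeff_C_mul_X_pow, if_neg]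
        exact fun h => hAU (Finset.eq_of_subset_of_card_le (hc A hA) h.le)
    · simp

theorem MultiAffine.pderiv_pderiv {g : MvPolynomial (Fin n) ℝ} (hg : MultiAffine g) (i : Fin n) :
    MvPolynomial.pderiv i (MvPolynomial.pderiv i g) = 0 := by
  rw [hg.eq_multiAffineOf, pderiv_multiAffineOf]
  exact pderiv_multiAffineOf_eq_zero i fun A hA => if_pos hA

theorem stableOfDegree_one {g : MvPolynomial (Fin n) ℝ} (hs : RealStable g) (hg : MultiAffine g)
    (h1 : MvPolynomial.coeff (expOf Finset.univ) g = 1) : StableOfDegree g fun _ => 1 := by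
  refine ⟨hg.pderiv_pderiv, 1, one_pos, fun z hz => ?_⟩
  set v : Fin n → Polynomial ℂ := fun j =>
    Polynomial.C ((z j).re : ℂ) + Polynomial.X * Polynomial.C ((z j).im : ℂ) with hv
  have hvd : ∀ j, (v j).natDegree ≤ 1 := fun j => by
    simp only [hv]
    compute_degree
  set F : Polynomial ℂ := MvPolynomial.aeval v g with hF
  have heval : ∀ t, F.eval t = MvPolynomial.aeval (fun j => ((z j).re : ℂ) + t * (z j).im) g := by
    intro t
    rw [hF, ← Polynomial.coe_evalRingHom, MvPolynomial.aeval_def, MvPolynomial.aeval_def,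
      MvPolynomial.hom_eval₂]
    congr 1
    · ext x; simp [Polynomial.algebraMap_apply]
    · funext j; simp only [hv, Polynomial.coe_evalRingHom, Polynomial.eval_add,
        Polynomial.eval_mul, Polynomial.eval_C, Polynomial.eval_X]
  have hFsum : F = ∑ A : Finset (Fin n),
      Polynomial.C ((MvPolynomial.coeff (expOf A) g : ℝ) : ℂ) * ∏ j ∈ A, v j := by
    conv_lhs => rw [hF, hg.eq_multiAffineOf]
    simp [multiAffineOf, Polynomial.algebraMap_apply]
  have hAd : ∀ A : Finset (Fin n),
      (Polynomial.C ((MvPolynomial.coeff (expOf A) g : ℝ) : ℂ) * ∏ j ∈ A, v j).natDegree ≤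
        A.card := fun A => by
    refine (Polynomial.natDegree_C_mul_le _ _).trans ((Polynomial.natDegree_prod_le _ _).trans ?_)
    exact (Finset.sum_le_card_nsmul _ _ 1 fun j _ => hvd j).trans (by simp)
  have hdeg : F.natDegree ≤ n := by
    rw [hFsum]
    exact Polynomial.natDegree_sum_le_of_forall_le _ _ fun A _ => (hAd A).trans (by
      simpa using Finset.card_le_univ A)
  have hcoeff : F.coeff n = ∏ j, ((z j).im : ℂ) := by
    rw [hFsum, Polynomial.finsetSum_coeff, Finset.sum_eq_single Finset.univ]
    · have := Polynomial.coeff_prod_of_natDegree_le Finset.univ v 1 fun j _ => hvd j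
      rw [Finset.card_univ, Fintype.card_fin, mul_one] at this
      rw [h1, Polynomial.coeff_C_mul, this]
      simp [hv, Polynomial.coeff_C]
    · intro A _ hA
      refine Polynomial.coeff_eq_zero_of_natDegree_lt ((hAd A).trans_lt ?_)
      simpa using Finset.card_lt_card (Finset.ssubset_univ_iff.mpr hA)
    · simp
  have := norm_coeff_mul_im_pow_le hdeg (fun t ht => ?_) Complex.I (by simp)
  · have hz' : (fun j => ((z j).re : ℂ) + Complex.I * (z j).im) = z := by
      funext j
      apply Complex.ext <;> simp
    rw [hcoeff, heval, hz', Complex.I_im, one_pow, mul_one, norm_prod] at this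
    rw [one_mul]
    refine le_trans (le_of_eq ?_) this
    refine Finset.prod_congr rfl fun j _ => ?_
    rw [Complex.norm_real, Real.norm_of_nonneg (hz j).le, pow_one]
  · rw [heval]
    have := hs (fun j => ((z j).re : ℂ) + t * (z j).im) (fun i => by
      simpa using mul_pos ht (hz i))
    rwa [MvPolynomial.eval_map, ← MvPolynomial.aeval_def] at this

theorem StableOfDegree.pow {g : MvPolynomial (Fin n) ℝ} (hs : StableOfDegree g fun _ => 1)
    (r : ℕ) : StableOfDegree (g ^ r) fun _ => r := by
  refine ⟨fun i => ?_, ?_⟩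
  · have := (Derivation.iterate_prod_of_sq_eq_zero (MvPolynomial.pderiv (R := ℝ) i)
      (Finset.univ : Finset (Fin r)) (fun _ => g) (fun _ _ => hs.iterate_pderiv_eq_zero i)).1
    simpa using this
  · obtain ⟨c, hc, hb⟩ := hs.exists_bound
    refine ⟨c ^ r, pow_pos hc r, fun z hz => ?_⟩
    have h0 : 0 ≤ c * ∏ i, (z i).im ^ 1 :=
      mul_nonneg hc.le (Finset.prod_nonneg fun i _ => pow_nonneg (hz i).le _)
    have := pow_le_pow_left₀ h0 (hb z hz) r
    rw [map_pow, norm_pow]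
    refine le_trans (le_of_eq ?_) this
    rw [mul_pow, ← Finset.prod_pow]
    simp

end MultiAffineForm

theorem aeval_diagPoly {n : ℕ} {K : Type*} [CommRing K] [Algebra ℝ K] (t : K)
    (p : MvPolynomial (Fin n) ℝ) :
    Polynomial.aeval t (diagPoly p) = MvPolynomial.aeval (fun _ => t) p := by
  have : (Polynomial.aeval t).comp (MvPolynomial.aeval (fun _ : Fin n => Polynomial.X)) =
      MvPolynomial.aeval (R := ℝ) (fun _ => t) := by
    ext; simp
  exact DFunLike.congr_fun this p

theorem eval_diagPoly {n : ℕ} (t : ℝ) (p : MvPolynomial (Fin n) ℝ) :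
    (diagPoly p).eval t = MvPolynomial.aeval (fun _ => t) p := by
  rw [← aeval_diagPoly, Polynomial.coe_aeval_eq_eval]

theorem exists_interlacing_weights {F H : Polynomial ℝ} {m : ℕ} {a : ℝ} (hFd : F.natDegree ≤ m + 1)
    (hF1 : F.coeff (m + 1) = 1) (hHd : H.natDegree ≤ m) (hH1 : H.coeff m = 1)
    (hGa : (F - Polynomial.X * H).coeff m = a)
    (hF : ∀ t : ℂ, 0 < t.im → Polynomial.aeval t F ≠ 0)
    (him : ∀ t : ℂ, 0 < t.im →
      (Polynomial.aeval t H * (starRingEnd ℂ) (Polynomial.aeval t F)).im ≤ 0) :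
    ∃ l w : Fin (m + 1) → ℝ, (∀ k, 0 ≤ w k) ∧ ∑ k, w k = 1 ∧ ∑ k, w k * l k = -a ∧
      F = ∏ k, (Polynomial.X - Polynomial.C (l k)) ∧
      H = ∑ k, Polynomial.C (w k) * ∏ j ∈ Finset.univ.erase k, (Polynomial.X - Polynomial.C (l j)) := by
  have hdeg : F.natDegree = m + 1 :=
    le_antisymm hFd (Polynomial.le_natDegree_of_ne_zero (by rw [hF1]; exact one_ne_zero))
  have hsp : F.Splits := splits_of_forall_im_pos fun t ht => by
    have := hF t ht
    rwa [Polynomial.aeval_def, ← Polynomial.eval_map] at this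
  obtain ⟨l, hl⟩ := hsp.exists_eq_C_mul_prod hdeg
  rw [Polynomial.leadingCoeff, hdeg, hF1, Polynomial.C_1, one_mul] at hl
  obtain ⟨c, w, hw, hH⟩ := exists_partial_fraction l Finset.univ H (by simp; omega)
    (by rwa [← hl])
  have herase : ∀ k, (∏ j ∈ Finset.univ.erase k,
      (Polynomial.X - Polynomial.C (l j))).natDegree = m := fun k => by
    rw [Polynomial.natDegree_prod_of_monic _ _ fun j _ => Polynomial.monic_X_sub_C _]
    simp
  have herase1 : ∀ k, (∏ j ∈ Finset.univ.erase k,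
      (Polynomial.X - Polynomial.C (l j))).coeff m = 1 := fun k => by
    have := (Polynomial.monic_prod_of_monic (Finset.univ.erase k)
      (fun j => Polynomial.X - Polynomial.C (l j)) fun j _ => Polynomial.monic_X_sub_C _)
    rw [Polynomial.Monic, Polynomial.leadingCoeff, herase] at this
    exact this
  have hc : c = 0 := by
    have h0 : H.coeff (m + 1) = 0 := Polynomial.coeff_eq_zero_of_natDegree_lt (by omega)
    rw [hH, ← hl, Polynomial.coeff_add, Polynomial.coeff_C_mul, hF1, Polynomial.finsetSum_coeff,
      Finset.sum_eq_zero] at h0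
    · simpa using h0
    · intro k _
      rw [Polynomial.coeff_C_mul, Polynomial.coeff_eq_zero_of_natDegree_lt (by rw [herase]; omega),
        mul_zero]
  rw [hc, Polynomial.C_0, zero_mul, zero_add] at hH
  have hw1 : ∑ k, w k = 1 := by
    rw [← hH1, hH, Polynomial.finsetSum_coeff]
    refine Finset.sum_congr rfl fun k _ => ?_
    rw [Polynomial.coeff_C_mul, herase1, mul_one]
  refine ⟨l, w, hw, hw1, ?_, hl, hH⟩
  have hG : F - Polynomial.X * H = -∑ k, Polynomial.C (w k * l k) *
      ∏ j ∈ Finset.univ.erase k, (Polynomial.X - Polynomial.C (l j)) := by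
    have h1 : F = ∑ k, Polynomial.C (w k) * ((Polynomial.X - Polynomial.C (l k)) *
        ∏ j ∈ Finset.univ.erase k, (Polynomial.X - Polynomial.C (l j))) := by
      rw [← one_mul F, ← Polynomial.C_1, ← hw1, map_sum, Finset.sum_mul]
      refine Finset.sum_congr rfl fun k _ => ?_
      rw [Finset.mul_prod_erase _ (fun j => Polynomial.X - Polynomial.C (l j)) (Finset.mem_univ k),
        ← hl]
    rw [hH, Finset.mul_sum]
    nth_rewrite 1 [h1]
    rw [← Finset.sum_sub_distrib, ← Finset.sum_neg_distrib]
    refine Finset.sum_congr rfl fun k _ => ?_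
    rw [Polynomial.C_mul]
    ring
  rw [← hGa, hG, Polynomial.coeff_neg, Polynomial.finsetSum_coeff, neg_neg]
  refine Finset.sum_congr rfl fun k _ => ?_
  rw [Polynomial.coeff_C_mul, herase1, mul_one]

section Base

variable {n : ℕ} {g : MvPolynomial (Fin n) ℝ}

theorem StableOfDegree.pderivs (hs : StableOfDegree g fun _ => 1) (S : Finset (Fin n)) :
    StableOfDegree (pderivs S g) fun i => if i ∈ S then 0 else 1 := by
  rw [← iterPderivs_one]
  exact hs.iterPderivs fun _ _ => le_rfl

theorem pderiv_pderivs {i : Fin n} {S : Finset (Fin n)} (hi : i ∉ S) :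
    MvPolynomial.pderiv i (pderivs S g) = pderivs (insert i S) g := by
  rw [← iterPderivs_one, ← iterPderivs_one, iterPderivs_insert 1 hi, Function.iterate_one]

theorem StableOfDegree.aeval_ne_zero {p : MvPolynomial (Fin n) ℝ} {d : Fin n → ℕ}
    (h : StableOfDegree p d) {z : Fin n → ℂ} (hz : ∀ i, 0 < (z i).im) :
    MvPolynomial.aeval z p ≠ 0 := by
  obtain ⟨c, hc, hb⟩ := h.exists_bound
  rw [← norm_pos_iff]
  exact (mul_pos hc (Finset.prod_pos fun i _ => pow_pos (hz i) _)).trans_le (hb z hz)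

theorem MultiAffine.natDegree_diagPoly_pderivs (hg : MultiAffine g)
    (h1 : MvPolynomial.coeff (expOf Finset.univ) g = 1) (S : Finset (Fin n)) :
    (diagPoly (pderivs S g)).natDegree ≤ Sᶜ.card ∧
      (diagPoly (pderivs S g)).coeff Sᶜ.card = 1 := by
  have := natDegree_diagPoly_multiAffineOf (U := Sᶜ) (c := fun A => if Disjoint A S then
    (fun A => MvPolynomial.coeff (expOf A) g) (A ∪ S) else 0) (fun A hA => by
      refine le_compl_iff_disjoint_right.mpr ?_
      by_contra h
      exact hA (if_neg h))
  rw [← pderivs_multiAffineOf S fun A => MvPolynomial.coeff (expOf A) g, ← hg.eq_multiAffineOf, if_pos disjoint_compl_left] at this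
  have hU : Sᶜ ∪ S = Finset.univ := by rw [Finset.union_comm, Finset.union_compl]
  simpa [hU, h1] using this

theorem MultiAffine.coeff_diagPoly_pderivs_sub (hg : MultiAffine g) {i : Fin n}
    {S : Finset (Fin n)} (hi : i ∉ S) :
    (diagPoly (pderivs S g) - Polynomial.X * diagPoly (pderivs (insert i S) g)).coeff
      (insert i S)ᶜ.card = MvPolynomial.coeff (expOf {i}ᶜ) g := by
  set c : Finset (Fin n) → ℝ := fun A => if Disjoint A S then
    (fun A => MvPolynomial.coeff (expOf A) g) (A ∪ S) else 0 with hc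
  have h1 : pderivs S g = multiAffineOf c := by
    conv_lhs => rw [hg.eq_multiAffineOf, pderivs_multiAffineOf]
  have h2 := multiAffineOf_eq i c
  rw [← pderiv_multiAffineOf, ← h1, pderiv_pderivs hi] at h2
  have h3 := congrArg diagPoly h2
  have h4 := (natDegree_diagPoly_multiAffineOf (U := (insert i S)ᶜ)
    (c := fun A => if i ∈ A then 0 else c A) (fun A hA => by
      refine le_compl_iff_disjoint_right.mpr ?_
      by_contra h
      refine hA ?_
      simp only [hc]
      rw [Finset.disjoint_insert_right] at h
      by_cases hiA : i ∈ A
      · simp [hiA]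
      · rw [if_neg hiA, if_neg fun hd => h ⟨hiA, hd⟩])).2
  have h5 : diagPoly (pderivs S g) - Polynomial.X * diagPoly (pderivs (insert i S) g) =
      diagPoly (multiAffineOf fun A => if i ∈ A then 0 else c A) := by
    rw [h3]
    simp [diagPoly]
  rw [h5, h4, if_neg (by simp)]
  simp only [hc]
  rw [if_pos]
  · congr 2
    ext j
    by_cases hj : j = i
    · subst hj; simp [hi]
    · by_cases hjS : j ∈ S <;> simp [hj, hjS]
  · exact Finset.disjoint_left.mpr fun j hj hjS => by simp [hjS] at hj

theorem exists_weights_pderivs (hs : StableOfDegree g fun _ => 1) (hg : MultiAffine g)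
    (h1 : MvPolynomial.coeff (expOf Finset.univ) g = 1) {i : Fin n} {S : Finset (Fin n)}
    (hi : i ∉ S) :
    ∃ (m : ℕ) (l w : Fin (m + 1) → ℝ), (∀ k, 0 ≤ w k) ∧ ∑ k, w k = 1 ∧
      ∑ k, w k * l k = -MvPolynomial.coeff (expOf {i}ᶜ) g ∧
      (∀ t, (diagPoly (pderivs S g)).eval t = ∏ k, (t - l k)) ∧
      ∀ t, (diagPoly (pderivs (insert i S) g)).eval t =
        ∑ k, w k * ∏ j ∈ Finset.univ.erase k, (t - l j) := by
  have hcard : Sᶜ.card = (insert i S)ᶜ.card + 1 := by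
    rw [Finset.compl_insert, Finset.card_erase_add_one (by simpa using hi)]
  obtain ⟨hFd, hF1⟩ := hg.natDegree_diagPoly_pderivs h1 S
  obtain ⟨hHd, hH1⟩ := hg.natDegree_diagPoly_pderivs h1 (insert i S)
  rw [hcard] at hFd hF1
  obtain ⟨l, w, hw, hw1, hwl, hF, hH⟩ := exists_interlacing_weights hFd hF1 hHd hH1
    (hg.coeff_diagPoly_pderivs_sub hi) (fun t ht => by
      rw [aeval_diagPoly]
      exact (hs.pderivs S).aeval_ne_zero fun _ => ht) (fun t ht => by
      rw [aeval_diagPoly, aeval_diagPoly, ← pderiv_pderivs hi]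
      exact (hs.pderivs S).im_pderiv_mul_conj_nonpos i fun _ => ht.le)
  refine ⟨_, l, w, hw, hw1, hwl, fun t => ?_, fun t => ?_⟩
  · rw [hF, Polynomial.eval_prod]
    simp
  · rw [hH, Polynomial.eval_finsetSum]
    simp [Polynomial.eval_prod]

theorem isRoot_diagPoly_pderivs (hs : StableOfDegree g fun _ => 1) (hg : MultiAffine g)
    (h1 : MvPolynomial.coeff (expOf Finset.univ) g = 1)
    (hroots : ∀ x : ℝ, (diagPoly g).IsRoot x → x ∈ Set.Icc (0 : ℝ) 1) (S : Finset (Fin n)) :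
    ∀ x : ℝ, (diagPoly (pderivs S g)).eval x = 0 → x ∈ Set.Icc (0 : ℝ) 1 := by
  induction S using Finset.induction_on with
  | empty => simpa [← iterPderivs_one] using hroots
  | insert i S hi ih =>
    intro x hx
    obtain ⟨m, l, w, hw, hw1, -, hF, hH⟩ := exists_weights_pderivs hs hg h1 hi
    have hl : ∀ k, l k ∈ Set.Icc (0 : ℝ) 1 := fun k => ih _ (by
      rw [hF]; exact Finset.prod_eq_zero (Finset.mem_univ k) (sub_self _))
    obtain ⟨k₀, -, hk₀⟩ : ∃ k ∈ Finset.univ, 0 < w k := by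
      by_contra! h
      have := Finset.sum_nonpos h
      linarith
    rw [hH] at hx
    refine ⟨?_, ?_⟩ <;> by_contra! hlt
    · have h2 : ∀ k, ∏ j ∈ Finset.univ.erase k, (x - l j) =
          (-1) ^ m * ∏ j ∈ Finset.univ.erase k, (l j - x) := fun k => by
        have : (Finset.univ.erase k).card = m := by simp
        have h3 : (-1 : ℝ) ^ m = ∏ j ∈ Finset.univ.erase k, (-1) := by
          rw [Finset.prod_const, this]
        rw [h3, ← Finset.prod_mul_distrib]
        exact Finset.prod_congr rfl fun j _ => by ring
      have h3 : ∑ k, w k * ∏ j ∈ Finset.univ.erase k, (x - l j) =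
          (-1) ^ m * ∑ k, w k * ∏ j ∈ Finset.univ.erase k, (l j - x) := by
        rw [Finset.mul_sum]
        exact Finset.sum_congr rfl fun k _ => by rw [h2]; ring
      have h4 : 0 < ∑ k, w k * ∏ j ∈ Finset.univ.erase k, (l j - x) := by
        have h5 : ∀ k, 0 < ∏ j ∈ Finset.univ.erase k, (l j - x) := fun k =>
          Finset.prod_pos fun j _ => by linarith [(hl j).1]
        exact Finset.sum_pos' (fun k _ => mul_nonneg (hw k) (h5 k).le)
          ⟨k₀, Finset.mem_univ _, mul_pos hk₀ (h5 k₀)⟩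
      rw [h3] at hx
      rcases mul_eq_zero.mp hx with h | h
      · exact pow_ne_zero _ (by norm_num) h
      · exact h4.ne' h
    · have h5 : ∀ k, 0 < ∏ j ∈ Finset.univ.erase k, (x - l j) := fun k =>
          Finset.prod_pos fun j _ => by linarith [(hl j).2]
      exact (Finset.sum_pos' (fun k _ => mul_nonneg (hw k) (h5 k).le)
          ⟨k₀, Finset.mem_univ _, mul_pos hk₀ (h5 k₀)⟩).ne' hx

/-- Bounds for `g_S` and for its logarithmic derivatives on the diagonal, above the interval
containing the roots. -/
theorem pderivs_diagonal_bounds (hs : StableOfDegree g fun _ => 1) (hg : MultiAffine g)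
    (h1 : MvPolynomial.coeff (expOf Finset.univ) g = 1)
    (hroots : ∀ x : ℝ, (diagPoly g).IsRoot x → x ∈ Set.Icc (0 : ℝ) 1) {α : ℝ}
    (hα : ∀ i : Fin n, |MvPolynomial.coeff (expOf ({i} : Finset (Fin n))ᶜ) g| ≤ α)
    {b : ℝ} (hb : 1 < b) (S : Finset (Fin n)) :
    0 < MvPolynomial.aeval (fun _ => b) (pderivs S g) ∧
    ∀ i ∉ S,
      MvPolynomial.aeval (fun _ => b) (pderivs S g) ≤
        b * MvPolynomial.aeval (fun _ => b) (pderivs (insert i S) g) ∧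
      MvPolynomial.aeval (fun _ => b) (pderivs (insert i S) g) ≤
        (1 / b + α / (b * (b - 1))) * MvPolynomial.aeval (fun _ => b) (pderivs S g) := by
  have hb0 : 0 < b := by linarith
  have key : ∀ i ∉ S, 0 < MvPolynomial.aeval (fun _ => b) (pderivs S g) ∧
      MvPolynomial.aeval (fun _ => b) (pderivs S g) ≤
        b * MvPolynomial.aeval (fun _ => b) (pderivs (insert i S) g) ∧
      MvPolynomial.aeval (fun _ => b) (pderivs (insert i S) g) ≤
        (1 / b + α / (b * (b - 1))) * MvPolynomial.aeval (fun _ => b) (pderivs S g) := by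
    intro i hi
    obtain ⟨m, l, w, hw, hw1, hwl, hF, hH⟩ := exists_weights_pderivs hs hg h1 hi
    have hl : ∀ k, l k ∈ Set.Icc (0 : ℝ) 1 := fun k =>
      isRoot_diagPoly_pderivs hs hg h1 hroots S _ (by
        rw [hF]; exact Finset.prod_eq_zero (Finset.mem_univ k) (sub_self _))
    rw [← eval_diagPoly, ← eval_diagPoly, hF, hH]
    have hu : ∀ k, 0 < b - l k := fun k => by linarith [(hl k).2]
    have hP : 0 < ∏ k, (b - l k) := Finset.prod_pos fun k _ => hu k
    have hsum : ∑ k, w k * ∏ j ∈ Finset.univ.erase k, (b - l j) =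
        (∑ k, w k * (1 / (b - l k))) * ∏ k, (b - l k) := by
      rw [Finset.sum_mul]
      refine Finset.sum_congr rfl fun k _ => ?_
      rw [← Finset.mul_prod_erase _ _ (Finset.mem_univ k)]
      have := (hu k).ne'
      field_simp
    refine ⟨hP, ?_, ?_⟩
    · rw [hsum, ← mul_assoc]
      refine le_mul_of_one_le_left hP.le ?_
      refine hw1.symm.le.trans ?_
      rw [Finset.mul_sum]
      refine Finset.sum_le_sum fun k _ => ?_
      have : 1 ≤ b * (1 / (b - l k)) := by
        rw [mul_one_div, le_div_iff₀ (hu k)]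
        linarith [(hl k).1]
      nlinarith [hw k]
    · rw [hsum]
      refine mul_le_mul_of_nonneg_right ?_ hP.le
      have h2 : ∑ k, w k * (1 / (b - l k)) ≤ ∑ k, (w k * (1 / b) + w k * l k * (1 / (b * (b - 1)))) := by
        refine Finset.sum_le_sum fun k _ => ?_
        rw [mul_assoc, ← mul_add]
        refine mul_le_mul_of_nonneg_left ?_ (hw k)
        have hb1 : 0 < b - 1 := by linarith
        have := hu k
        have h3 : 1 / (b - l k) = 1 / b + l k * (1 / (b * (b - l k))) := by
          field_simp
          ring
        rw [h3]
        gcongr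
        · exact (hl k).1
        · exact (hl k).2
      rw [Finset.sum_add_distrib, ← Finset.sum_mul, ← Finset.sum_mul, hw1, hwl, one_mul] at h2
      refine h2.trans ?_
      rw [mul_one_div]
      have hb1 : 0 < b - 1 := by linarith
      gcongr
      exact (neg_le_abs _).trans (hα i)
  refine ⟨?_, fun i hi => (key i hi).2⟩
  by_cases h : ∃ i, i ∉ S
  · obtain ⟨i, hi⟩ := h
    exact (key i hi).1
  · push Not at h
    have hS : Sᶜ = ∅ := by ext j; simp [h j]
    obtain ⟨hFd, hF1⟩ := hg.natDegree_diagPoly_pderivs h1 S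
    rw [hS, Finset.card_empty] at hFd hF1
    rw [← eval_diagPoly, Polynomial.eq_C_of_natDegree_le_zero hFd, hF1]
    simp

end Base

theorem le_sum_sub_of_sum_inv_le {r : ℕ} (hr : 2 ≤ r) {b δ φ : ℝ} {u : Fin r → ℝ}
    (hu : ∀ k, 0 < u k) (hub : ∀ k, u k ≤ b) (hφ : ∑ k, 1 / u k ≤ φ)
    (hδ : r * δ * (φ - 1 / b) ≤ (r - 1) ^ 2) (k : Fin r) : u k ≤ ∑ j, u j - r * δ := by
  have hcs := Finset.sum_sq_le_sum_mul_sum_of_sq_le_mul (Finset.univ.erase k)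
    (r := fun _ => (1 : ℝ)) (f := u) (g := fun j => 1 / u j) (fun j _ => (hu j).le)
    (fun j _ => by have := hu j; positivity) (fun j _ => by have := (hu j).ne'; field_simp; rfl)
  have hcard : ((Finset.univ.erase k).card : ℝ) = r - 1 := by
    rw [Finset.card_erase_of_mem (Finset.mem_univ k), Finset.card_univ, Fintype.card_fin,
      Nat.cast_sub (by omega), Nat.cast_one]
  rw [Finset.sum_const, nsmul_eq_mul, mul_one, hcard] at hcs
  have h1 := Finset.add_sum_erase Finset.univ u (Finset.mem_univ k)
  have h2 := Finset.add_sum_erase Finset.univ (fun j => 1 / u j) (Finset.mem_univ k)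
  have h3 : 1 / b ≤ 1 / u k := one_div_le_one_div_of_le (hu k) (hub k)
  have hr1 : (1 : ℝ) ≤ r - 1 := by
    have : (2 : ℝ) ≤ r := by exact_mod_cast hr
    linarith
  set U := ∑ j ∈ Finset.univ.erase k, u j
  set V := ∑ j ∈ Finset.univ.erase k, 1 / u j
  have hU : 0 ≤ U := Finset.sum_nonneg fun j _ => (hu j).le
  have hV : V ≤ φ - 1 / b := by linarith
  have hUV : 0 < U * V := by nlinarith
  have hV0 : 0 < V := pos_of_mul_pos_right hUV hU
  have : r * δ ≤ U := by
    by_contra! h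
    nlinarith [mul_le_mul_of_nonneg_left hV hU]
  linarith

theorem exists_partial_fraction_C_mul {r : ℕ} {a : ℝ} (ha : 0 < a) (l : Fin r → ℝ)
    {F H : Polynomial ℝ} (hF : F = Polynomial.C a * ∏ k, (Polynomial.X - Polynomial.C (l k)))
    (hdeg : H.natDegree ≤ r)
    (him : ∀ t : ℂ, 0 < t.im →
      (Polynomial.aeval t H * (starRingEnd ℂ) (Polynomial.aeval t F)).im ≤ 0) :
    ∃ (c : ℝ) (m : Fin r → ℝ), (∀ k, 0 ≤ m k) ∧ H.coeff r = a * c ∧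
      H = Polynomial.C a * (Polynomial.C c * ∏ k, (Polynomial.X - Polynomial.C (l k)) +
        ∑ k, Polynomial.C (m k) *
          ∏ j ∈ Finset.univ.erase k, (Polynomial.X - Polynomial.C (l j))) := by
  obtain ⟨c, m, hm, hH⟩ := exists_partial_fraction l Finset.univ (Polynomial.C a⁻¹ * H)
    (by simpa using (Polynomial.natDegree_C_mul_le _ _).trans hdeg) (fun t ht => by
      have h1 := him t ht
      rw [hF, map_mul, Polynomial.aeval_C, map_mul, Complex.coe_algebraMap, Complex.conj_ofReal] at h1
      rw [map_mul, Polynomial.aeval_C, Complex.coe_algebraMap]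
      set P := Polynomial.aeval t H
      set Q := (starRingEnd ℂ) (Polynomial.aeval t (∏ k, (Polynomial.X - Polynomial.C (l k))))
      have h2 : P * ((a : ℂ) * Q) = ((a : ℝ) : ℂ) * (P * Q) := by ring
      rw [h2, Complex.im_ofReal_mul] at h1
      rw [mul_assoc, Complex.im_ofReal_mul]
      exact mul_nonpos_of_nonneg_of_nonpos (inv_nonneg.mpr ha.le)
        (nonpos_of_mul_nonpos_right h1 ha))
  have hH2 : H = Polynomial.C a * (Polynomial.C c * ∏ k, (Polynomial.X - Polynomial.C (l k)) +
        ∑ k, Polynomial.C (m k) *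
          ∏ j ∈ Finset.univ.erase k, (Polynomial.X - Polynomial.C (l j))) := by
    rw [← hH, ← mul_assoc, ← Polynomial.C_mul, mul_inv_cancel₀ ha.ne', Polynomial.C_1, one_mul]
  refine ⟨c, m, hm, ?_, hH2⟩
  have h1 : (∏ k : Fin r, (Polynomial.X - Polynomial.C (l k))).coeff r = 1 := by
    have h2 := Polynomial.natDegree_finsetProd_X_sub_C_eq_card Finset.univ l
    have h3 := Polynomial.monic_prod_X_sub_C l Finset.univ
    rw [Finset.card_univ, Fintype.card_fin] at h2
    rwa [Polynomial.Monic, Polynomial.leadingCoeff, h2] at h3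
  rw [hH2, Polynomial.coeff_C_mul, Polynomial.coeff_add, Polynomial.coeff_C_mul, h1, mul_one,
    Polynomial.finsetSum_coeff, Finset.sum_eq_zero, add_zero]
  intro k _
  have h2 := Polynomial.natDegree_finsetProd_X_sub_C_eq_card (Finset.univ.erase k) l
  rw [Polynomial.coeff_C_mul, Polynomial.coeff_eq_zero_of_natDegree_lt, mul_zero]
  rw [h2]
  simpa using k.pos

theorem aeval_slice {n : ℕ} (i : Fin n) (x : Fin n → ℝ) (p : MvPolynomial (Fin n) ℝ) (t : ℂ) :
    Polynomial.aeval t (slice i x p) =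
      MvPolynomial.aeval (Function.update (fun j => (x j : ℂ)) i t) p := by
  rw [← eval_slice, ← map_slice, Polynomial.aeval_def, Polynomial.eval_map]

section Shift

variable {n r : ℕ} {p : MvPolynomial (Fin n) ℝ} {d : Fin n → ℕ}

theorem update_ofReal_im_nonneg (i : Fin n) (x : Fin n → ℝ) {t : ℂ} (ht : 0 < t.im) (j : Fin n) :
    0 ≤ (Function.update (fun j => (x j : ℂ)) i t j).im := by
  by_cases hj : j = i
  · subst hj; simpa using ht.le
  · simp [hj]

theorem StableOfDegree.aeval_update_iterate_pderiv (h : StableOfDegree p d) (j : Fin n)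
    (x : Fin n → ℝ) (t : ℝ) :
    MvPolynomial.aeval (Function.update x j t) ((MvPolynomial.pderiv j)^[d j] p) =
      MvPolynomial.aeval x ((MvPolynomial.pderiv j)^[d j] p) := by
  conv_rhs => rw [← Function.update_eq_self j x]
  rw [h.eval_iterate_pderiv, h.eval_iterate_pderiv]

theorem StableOfDegree.exists_slice_eq (h : StableOfDegree p d) {j : Fin n} (hd : d j = r)
    {w : Fin n → ℝ} (hlead : 0 < MvPolynomial.aeval w ((MvPolynomial.pderiv j)^[r] p)) :
    ∃ (a : ℝ) (l : Fin r → ℝ), 0 < a ∧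
      slice j w p = Polynomial.C a * ∏ k, (Polynomial.X - Polynomial.C (l k)) := by
  subst hd
  obtain ⟨h1, h2, h3⟩ := h.splits_slice j hlead.ne'
  obtain ⟨l, hl⟩ := h1.exists_eq_C_mul_prod h2
  refine ⟨_, l, ?_, hl⟩
  rw [← h3] at hlead
  exact pos_of_mul_pos_right hlead (by positivity)

theorem StableOfDegree.exists_slice_eq_of_bounds (h : StableOfDegree p d) (hr : 2 ≤ r) {j : Fin n}
    (hd : d j = r) {w : Fin n → ℝ} {b δ φ : ℝ} (hw : w j = b)
    (hδ : r * δ * (φ - 1 / b) ≤ (r - 1) ^ 2)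
    (hlead : 0 < MvPolynomial.aeval w ((MvPolynomial.pderiv j)^[r] p))
    (hroots : ∀ x : ℝ, MvPolynomial.aeval (Function.update w j x) p = 0 → 0 ≤ x ∧ x < b)
    (hφ : MvPolynomial.aeval w (MvPolynomial.pderiv j p) ≤ φ * MvPolynomial.aeval w p) :
    ∃ (a : ℝ) (l : Fin r → ℝ), 0 < a ∧
      slice j w p = Polynomial.C a * ∏ k, (Polynomial.X - Polynomial.C (l k)) ∧
      (∀ k, 0 < b - l k) ∧ ∀ k, b - l k ≤ ∑ k, (b - l k) - r * δ := by
  obtain ⟨a, l, ha, hl⟩ := h.exists_slice_eq hd hlead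
  have hlr : ∀ k, 0 ≤ l k ∧ l k < b := fun k => hroots _ (by
    rw [← eval_slice, hl, Polynomial.eval_mul, Polynomial.eval_prod,
      Finset.prod_eq_zero (Finset.mem_univ k) (by simp), mul_zero])
  have hu : ∀ k, 0 < b - l k := fun k => by linarith [(hlr k).2]
  refine ⟨a, l, ha, hl, hu, le_sum_sub_of_sum_inv_le hr hu (fun k => by linarith [(hlr k).1])
    ?_ hδ⟩
  have hP : 0 < ∏ k, (b - l k) := Finset.prod_pos fun k _ => hu k
  have h1 : MvPolynomial.aeval w p = a * ∏ k, (b - l k) := by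
    have := eval_slice j w p b
    rw [hl, ← hw, Function.update_eq_self, hw] at this
    rw [← this]
    simp [Polynomial.eval_prod]
  have h2 : MvPolynomial.aeval w (MvPolynomial.pderiv j p) =
      a * (∏ k, (b - l k)) * ∑ k, 1 / (b - l k) := by
    have := eval_slice j w (MvPolynomial.pderiv j p) b
    rw [← derivative_slice, hl, ← hw, Function.update_eq_self, hw] at this
    rw [← this, Polynomial.derivative_C_mul, Polynomial.derivative_prod_finset,
      Polynomial.eval_mul, Polynomial.eval_finsetSum, Polynomial.eval_C, mul_assoc]
    congr 1
    rw [Finset.mul_sum]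
    refine Finset.sum_congr rfl fun k _ => ?_
    rw [← Finset.mul_prod_erase _ _ (Finset.mem_univ k)]
    have := (hu k).ne'
    field_simp
    simp [Polynomial.eval_prod]
  rw [h1, h2] at hφ
  have : 0 < a * ∏ k, (b - l k) := mul_pos ha hP
  nlinarith

theorem aeval_update_iterate_pderiv_of_slice_eq (hr : 2 ≤ r) {j : Fin n} {w : Fin n → ℝ} {a c : ℝ}
    {l m : Fin r → ℝ} {q : MvPolynomial (Fin n) ℝ}
    (hq : slice j w q = Polynomial.C a *
      (Polynomial.C c * ∏ k, (Polynomial.X - Polynomial.C (l k)) +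
        ∑ k, Polynomial.C (m k) *
          ∏ j ∈ Finset.univ.erase k, (Polynomial.X - Polynomial.C (l j)))) (t : ℝ) :
    MvPolynomial.aeval (Function.update w j t) ((MvPolynomial.pderiv j)^[r - 1] q) =
      a * (r - 1).factorial * (c * ∑ k, (t - l k) + ∑ k, m k) := by
  have : Nonempty (Fin r) := ⟨⟨0, by omega⟩⟩
  have h1 := (iterate_derivative_prod_X_sub_C Finset.univ l).2 Finset.univ_nonempty t
  have h2 : ∀ k, (Polynomial.derivative^[r - 1] (∏ j ∈ Finset.univ.erase k,
      (Polynomial.X - Polynomial.C (l j)))).eval t = (r - 1).factorial := fun k => by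
    have := (iterate_derivative_prod_X_sub_C (Finset.univ.erase k) l).1 t
    simpa using this
  rw [Finset.card_univ, Fintype.card_fin] at h1
  rw [← eval_slice, ← iterate_derivative_slice, hq, Polynomial.iterate_derivative_C_mul,
    iterate_map_add Polynomial.derivative, Polynomial.iterate_derivative_C_mul,
    Polynomial.iterate_derivative_sum, Polynomial.eval_mul, Polynomial.eval_add,
    Polynomial.eval_mul, h1, Polynomial.eval_finsetSum]
  simp only [Polynomial.iterate_derivative_C_mul, Polynomial.eval_mul, Polynomial.eval_C, h2]
  rw [← Finset.sum_mul]
  ring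

theorem StableOfDegree.pos_and_pderiv_le_of_shift (h : StableOfDegree p d) (hr : 2 ≤ r) {j : Fin n}
    (hd : d j = r) {w : Fin n → ℝ} {b δ φ : ℝ} (hw : w j = b)
    (hδ : r * δ * (φ - 1 / b) ≤ (r - 1) ^ 2)
    (hlead : 0 < MvPolynomial.aeval w ((MvPolynomial.pderiv j)^[r] p))
    (hroots : ∀ x : ℝ, MvPolynomial.aeval (Function.update w j x) p = 0 → 0 ≤ x ∧ x < b)
    (hφ : MvPolynomial.aeval w (MvPolynomial.pderiv j p) ≤ φ * MvPolynomial.aeval w p) :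
    0 < MvPolynomial.aeval (Function.update w j (b - δ)) ((MvPolynomial.pderiv j)^[r - 1] p) ∧
    ∀ i, MvPolynomial.aeval w (MvPolynomial.pderiv i p) ≤ φ * MvPolynomial.aeval w p →
      MvPolynomial.aeval (Function.update w j (b - δ))
        ((MvPolynomial.pderiv j)^[r - 1] (MvPolynomial.pderiv i p)) ≤
      φ * MvPolynomial.aeval (Function.update w j (b - δ))
        ((MvPolynomial.pderiv j)^[r - 1] p) := by
  obtain ⟨a, l, ha, hl, hu, huU⟩ := h.exists_slice_eq_of_bounds hr hd hw hδ hlead hroots hφ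
  set U := ∑ k, (b - l k) - r * δ with hU
  have hU0 : 0 < U := (hu ⟨0, by omega⟩).trans_le (huU _)
  have hsumU : ∑ k, (b - δ - l k) = U := by
    rw [hU]
    simp only [Finset.sum_sub_distrib, Finset.sum_const, Finset.card_univ, Fintype.card_fin,
      nsmul_eq_mul]
    ring
  have hp := aeval_update_iterate_pderiv_of_slice_eq hr (c := 1) (m := fun _ => 0)
    (by simpa using hl) (b - δ)
  rw [hsumU, one_mul, Finset.sum_const_zero, add_zero] at hp
  have hf : (0 : ℝ) < (r - 1).factorial := by exact_mod_cast Nat.factorial_pos _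
  refine ⟨by rw [hp]; positivity, fun i hi => ?_⟩
  obtain ⟨c, m, hm, -, hH⟩ := exists_partial_fraction_C_mul ha l hl
    (H := slice j w (MvPolynomial.pderiv i p)) (natDegree_le_of_iterate_derivative_eq_zero (by
      have h1 := MvPolynomial.iterate_pderiv_comm j i (r + 1) 1 p
      rw [← hd, h.iterate_pderiv_eq_zero, Function.iterate_one, map_zero] at h1
      rw [iterate_derivative_slice, ← hd, h1]
      simp [slice])) (fun t ht => by
      rw [aeval_slice, aeval_slice]
      exact h.im_pderiv_mul_conj_nonpos i (update_ofReal_im_nonneg j w ht))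
  rw [aeval_update_iterate_pderiv_of_slice_eq hr hH, hp, hsumU]
  have hP : 0 < ∏ k, (b - l k) := Finset.prod_pos fun k _ => hu k
  have h1 : MvPolynomial.aeval w p = a * ∏ k, (b - l k) := by
    have := eval_slice j w p b
    rw [hl, ← hw, Function.update_eq_self, hw] at this
    rw [← this]
    simp [Polynomial.eval_prod]
  have h2 : MvPolynomial.aeval w (MvPolynomial.pderiv i p) =
      a * (∏ k, (b - l k)) * (c + ∑ k, m k / (b - l k)) := by
    have := eval_slice j w (MvPolynomial.pderiv i p) b
    rw [hH, ← hw, Function.update_eq_self, hw] at this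
    rw [← this, Polynomial.eval_mul, Polynomial.eval_add, Polynomial.eval_finsetSum,
      Polynomial.eval_C, mul_assoc]
    congr 1
    rw [mul_add, Finset.mul_sum]
    congr 1
    · simp [Polynomial.eval_prod, mul_comm]
    · refine Finset.sum_congr rfl fun k _ => ?_
      rw [← Finset.mul_prod_erase _ _ (Finset.mem_univ k)]
      have := (hu k).ne'
      field_simp
      simp [Polynomial.eval_prod, mul_comm]
  rw [h1, h2] at hi
  have haP : 0 < a * ∏ k, (b - l k) := mul_pos ha hP
  have h3 : c + ∑ k, m k / (b - l k) ≤ φ := by nlinarith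
  have h4 : ∑ k, m k ≤ U * ∑ k, m k / (b - l k) := by
    rw [Finset.mul_sum]
    refine Finset.sum_le_sum fun k _ => ?_
    rw [← mul_div_assoc, le_div_iff₀ (hu k)]
    nlinarith [hm k, huU k]
  have h5 : c * U + ∑ k, m k ≤ φ * U := by nlinarith
  have : 0 < a * (r - 1).factorial := by positivity
  calc _ ≤ a * (r - 1).factorial * (φ * U) := by gcongr
    _ = _ := by ring

/-- Since `-p / ∂_j p` is increasing between its poles in the variable `z_i`, positivity of `p` at `b`
keeps the roots of `p` inside `[0, b)` as soon as those of `∂_j p` lie there. -/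
theorem StableOfDegree.root_bounds_of_pderiv (h : StableOfDegree p d) {i j : Fin n} (hij : i ≠ j)
    {k : ℕ} (hdj : d j = k + 1) (hd : d i = r) {w : Fin n → ℝ} {b : ℝ} (hw : w i = b)
    (hlead : 0 < MvPolynomial.aeval w ((MvPolynomial.pderiv i)^[r] (MvPolynomial.pderiv j p)))
    (hlead' : 0 < MvPolynomial.aeval w ((MvPolynomial.pderiv i)^[r] p))
    (hpos : 0 < MvPolynomial.aeval w p)
    (hroots : ∀ x : ℝ, MvPolynomial.aeval (Function.update w i x) (MvPolynomial.pderiv j p) = 0 →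
      0 ≤ x ∧ x < b) (x : ℝ) (hx : MvPolynomial.aeval (Function.update w i x) p = 0) :
    0 ≤ x ∧ x < b := by
  have h' := h.pderiv hdj
  have hd' : Function.update d j k i = r := by rw [Function.update_of_ne hij, hd]
  obtain ⟨a, l, ha, hl⟩ := h'.exists_slice_eq hd' hlead
  have hlr : ∀ k, 0 ≤ l k ∧ l k < b := fun k => hroots _ (by
    rw [← eval_slice, hl, Polynomial.eval_mul, Polynomial.eval_prod,
      Finset.prod_eq_zero (Finset.mem_univ k) (by simp), mul_zero])
  obtain ⟨c, m, hm, hc, hH⟩ := exists_partial_fraction_C_mul ha l hl (H := -slice i w p)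
    (by rw [Polynomial.natDegree_neg, ← hd]; exact h.natDegree_slice_le i w) (fun t ht => by
      have := h.im_pderiv_mul_conj_nonpos j (update_ofReal_im_nonneg i w ht)
      rw [← aeval_slice, ← aeval_slice] at this
      rw [map_neg, neg_mul]
      simp only [Complex.mul_im, Complex.neg_im, Complex.conj_re, Complex.conj_im] at this ⊢
      linarith)
  have hc0 : c < 0 := by
    have h1 := h.eval_iterate_pderiv i w (w i)
    rw [Function.update_eq_self, hd] at h1
    rw [h1] at hlead'
    have h2 : 0 < (slice i w p).coeff r := pos_of_mul_pos_right hlead' (by positivity)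
    rw [Polynomial.coeff_neg] at hc
    by_contra! h3
    nlinarith [mul_nonneg ha.le h3]
  have heval : ∀ t : ℝ, (∀ k, t - l k ≠ 0) → -MvPolynomial.aeval (Function.update w i t) p =
      a * (∏ k, (t - l k)) * (c + ∑ k, m k / (t - l k)) := by
    intro t ht
    have := congrArg (Polynomial.eval t) hH
    rw [Polynomial.eval_neg, eval_slice] at this
    rw [this, Polynomial.eval_mul, Polynomial.eval_add, Polynomial.eval_finsetSum,
      Polynomial.eval_C, mul_assoc]
    congr 1
    rw [mul_add, Finset.mul_sum]
    congr 1
    · simp [Polynomial.eval_prod, mul_comm]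
    · refine Finset.sum_congr rfl fun k _ => ?_
      rw [← Finset.mul_prod_erase _ _ (Finset.mem_univ k)]
      have := ht k
      field_simp
      simp [Polynomial.eval_prod, mul_comm]
  constructor <;> by_contra! hlt
  · have h1 := heval x fun k => by linarith [(hlr k).1]
    rw [hx, neg_zero] at h1
    have h2 : ∏ k, (x - l k) ≠ 0 := Finset.prod_ne_zero_iff.mpr fun k _ => by
      linarith [(hlr k).1]
    have h3 : ∑ k, m k / (x - l k) ≤ 0 := Finset.sum_nonpos fun k _ =>
      div_nonpos_of_nonneg_of_nonpos (hm k) (by linarith [(hlr k).1])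
    have h4 : c + ∑ k, m k / (x - l k) ≠ 0 := by linarith
    exact mul_ne_zero (mul_ne_zero ha.ne' h2) h4 h1.symm
  · have h1 := heval x fun k => by linarith [(hlr k).2]
    rw [hx, neg_zero] at h1
    have h2 : ∏ k, (x - l k) ≠ 0 := Finset.prod_ne_zero_iff.mpr fun k _ => by
      linarith [(hlr k).2]
    have h5 := heval b fun k => by linarith [(hlr k).2]
    rw [← hw, Function.update_eq_self, hw] at h5
    have h6 : 0 < ∏ k, (b - l k) := Finset.prod_pos fun k _ => by linarith [(hlr k).2]
    have h7 : c + ∑ k, m k / (b - l k) < 0 := by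
      by_contra! h8
      nlinarith [mul_nonneg (mul_pos ha h6).le h8]
    have h3 : ∑ k, m k / (x - l k) ≤ ∑ k, m k / (b - l k) := Finset.sum_le_sum fun k _ =>
      div_le_div_of_nonneg_left (hm k) (by linarith [(hlr k).2]) (by linarith)
    have h4 : c + ∑ k, m k / (x - l k) ≠ 0 := by linarith
    exact mul_ne_zero (mul_ne_zero ha.ne' h2) h4 h1.symm

end Shift

section Induction

variable {n : ℕ} {g : MvPolynomial (Fin n) ℝ} {r : ℕ}

/-- The polynomial `∏_{i ∈ T} ∂_i^{r-1} ∏_{i ∈ S} ∂_i^r g^r`. -/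
noncomputable def mixedPderivs (r : ℕ) (T S : Finset (Fin n)) (g : MvPolynomial (Fin n) ℝ) :
    MvPolynomial (Fin n) ℝ :=
  iterPderivs (r - 1) T (iterPderivs r S (g ^ r))

/-- The point with coordinates `b - δ` on `T` and `b` elsewhere. -/
noncomputable def shiftPoint (b δ : ℝ) (T : Finset (Fin n)) : Fin n → ℝ :=
  fun j => if j ∈ T then b - δ else b

theorem shiftPoint_insert (b δ : ℝ) (j : Fin n) (T : Finset (Fin n)) :
    shiftPoint b δ (insert j T) = Function.update (shiftPoint b δ T) j (b - δ) := by
  funext i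
  by_cases hi : i = j
  · subst hi; simp [shiftPoint]
  · simp [shiftPoint, hi]

theorem mixedPderivs_insert_left {j : Fin n} {T : Finset (Fin n)} (hj : j ∉ T)
    (S : Finset (Fin n)) : mixedPderivs r (insert j T) S g =
      (MvPolynomial.pderiv j)^[r - 1] (mixedPderivs r T S g) :=
  iterPderivs_insert _ hj _

theorem mixedPderivs_insert_right {j : Fin n} {S : Finset (Fin n)} (hj : j ∉ S)
    (T : Finset (Fin n)) : mixedPderivs r T (insert j S) g =
      (MvPolynomial.pderiv j)^[r] (mixedPderivs r T S g) := by
  rw [mixedPderivs, mixedPderivs, iterPderivs_insert r hj, iterate_pderiv_iterPderivs r (r - 1)]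

theorem StableOfDegree.mixedPderivs (hs : StableOfDegree g fun _ => 1) {T S : Finset (Fin n)}
    (hTS : Disjoint T S) : StableOfDegree (mixedPderivs r T S g) fun i =>
      if i ∈ T then (if i ∈ S then r - r else r) - (r - 1) else if i ∈ S then r - r else r :=
  ((hs.pow r).iterPderivs fun _ _ => le_rfl).iterPderivs fun i hi => by
    rw [if_neg (Finset.disjoint_left.mp hTS hi)]; omega

/-- Positivity, location of roots and bound on logarithmic derivatives of `mixedPderivs r T S g` at
`shiftPoint b δ T`, in the variables outside `T` and `S`. -/
structure ShiftBounds (r : ℕ) (g : MvPolynomial (Fin n) ℝ) (b δ φ : ℝ) (T S : Finset (Fin n)) :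
    Prop where
  pos : 0 < MvPolynomial.aeval (shiftPoint b δ T) (mixedPderivs r T S g)
  roots : ∀ i ∉ T, i ∉ S → ∀ x : ℝ,
    MvPolynomial.aeval (Function.update (shiftPoint b δ T) i x) (mixedPderivs r T S g) = 0 →
      0 ≤ x ∧ x < b
  pderiv_le : ∀ i ∉ T, i ∉ S →
    MvPolynomial.aeval (shiftPoint b δ T) (MvPolynomial.pderiv i (mixedPderivs r T S g)) ≤
      φ * MvPolynomial.aeval (shiftPoint b δ T) (mixedPderivs r T S g)

theorem shiftBounds_insert (hr : 2 ≤ r) (hs : StableOfDegree g fun _ => 1) {b δ φ : ℝ}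
    (hδ : r * δ * (φ - 1 / b) ≤ (r - 1) ^ 2) {T : Finset (Fin n)}
    (h : ∀ S, Disjoint T S → ShiftBounds r g b δ φ T S) {j : Fin n} (hj : j ∉ T)
    {S : Finset (Fin n)} (hS : Disjoint (insert j T) S) :
    ShiftBounds r g b δ φ (insert j T) S := by
  have key : ∀ S, Disjoint (insert j T) S →
      0 < MvPolynomial.aeval (shiftPoint b δ (insert j T)) (mixedPderivs r (insert j T) S g) ∧
      ∀ i ∉ T, i ∉ S → MvPolynomial.aeval (shiftPoint b δ (insert j T))
          (MvPolynomial.pderiv i (mixedPderivs r (insert j T) S g)) ≤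
        φ * MvPolynomial.aeval (shiftPoint b δ (insert j T))
          (mixedPderivs r (insert j T) S g) := by
    intro S hS
    rw [Finset.disjoint_insert_left] at hS
    obtain ⟨hjS, hTS⟩ := hS
    have h1 := (hs.mixedPderivs (r := r) hTS).pos_and_pderiv_le_of_shift hr (j := j)
      (by simp [hj, hjS]) (w := shiftPoint b δ T) (by simp [shiftPoint, hj]) hδ
      (by
        rw [← mixedPderivs_insert_right hjS]
        exact (h _ (Finset.disjoint_insert_right.mpr ⟨hj, hTS⟩)).pos)
      ((h S hTS).roots j hj hjS) ((h S hTS).pderiv_le j hj hjS)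
    rw [mixedPderivs_insert_left hj, shiftPoint_insert]
    refine ⟨h1.1, fun i hi hiS => ?_⟩
    have h2 := MvPolynomial.iterate_pderiv_comm i j 1 (r - 1) (_root_.mixedPderivs r T S g)
    rw [Function.iterate_one] at h2
    rw [h2]
    exact h1.2 i ((h S hTS).pderiv_le i hi hiS)
  refine ⟨(key S hS).1, fun i hi hiS => ?_, fun i hi =>
    (key S hS).2 i fun h => hi (Finset.mem_insert_of_mem h)⟩
  have hst := hs.mixedPderivs (r := r) hS
  rw [Finset.disjoint_insert_left] at hS
  obtain ⟨hjS, hTS⟩ := hS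
  rw [Finset.mem_insert, not_or] at hi
  obtain ⟨hij, hiT⟩ := hi
  have hpd : ∀ S', j ∉ S' → MvPolynomial.pderiv j (_root_.mixedPderivs r (insert j T) S' g) =
      _root_.mixedPderivs r T (insert j S') g := by
    intro S' hjS'
    rw [mixedPderivs_insert_left hj, mixedPderivs_insert_right hjS',
      ← Function.iterate_succ_apply' (MvPolynomial.pderiv j)]
    congr 2
    omega
  have hmove : ∀ S', j ∉ S' → Disjoint T S' → ∀ (x : Fin n → ℝ) (t : ℝ),
      MvPolynomial.aeval (Function.update x j t) (_root_.mixedPderivs r T (insert j S') g) =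
        MvPolynomial.aeval x (_root_.mixedPderivs r T (insert j S') g) := by
    intro S' hjS' hTS' x t
    have := (hs.mixedPderivs (r := r) hTS').aeval_update_iterate_pderiv j x t
    simp only [hj, hjS', if_false] at this
    rw [mixedPderivs_insert_right hjS', this]
  have hTiS : Disjoint T (insert i S) := Finset.disjoint_insert_right.mpr ⟨hiT, hTS⟩
  have hjiS : j ∉ insert i S := by simp [hjS, Ne.symm hij]
  refine hst.root_bounds_of_pderiv (r := r) hij (k := 0) (by simp [hjS]; omega)
    (by simp [hij, hiT, hiS]) (by simp [shiftPoint, hij, hiT]) ?_ ?_ (key S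
      (Finset.disjoint_insert_left.mpr ⟨hjS, hTS⟩)).1 fun x hx => ?_
  · have h2 := MvPolynomial.iterate_pderiv_comm i j r 1
      (_root_.mixedPderivs r (insert j T) S g)
    rw [Function.iterate_one] at h2
    rw [h2, ← mixedPderivs_insert_right hiS, hpd _ hjiS, shiftPoint_insert, hmove _ hjiS hTiS]
    exact (h _ (Finset.disjoint_insert_right.mpr ⟨hj, hTiS⟩)).pos
  · rw [← mixedPderivs_insert_right hiS]
    exact (key _ (Finset.disjoint_insert_left.mpr ⟨hjiS, hTiS⟩)).1
  · rw [hpd _ hjS, shiftPoint_insert, Function.update_comm (Ne.symm hij), hmove _ hjS hTS] at hx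
    exact (h _ (Finset.disjoint_insert_right.mpr ⟨hj, hTS⟩)).roots i hiT (by simp [hij, hiS]) x hx

theorem iterate_pderiv_C_mul (i : Fin n) (m : ℕ) (c : ℝ) (p : MvPolynomial (Fin n) ℝ) :
    (MvPolynomial.pderiv i)^[m] (MvPolynomial.C c * p) =
      MvPolynomial.C c * (MvPolynomial.pderiv i)^[m] p := by
  induction m with
  | zero => rfl
  | succ m ih => rw [Function.iterate_succ_apply', ih, MvPolynomial.pderiv_C_mul,
      Function.iterate_succ_apply']

theorem iterPderivs_pow (hs : StableOfDegree g fun _ => 1) (r : ℕ) (S : Finset (Fin n)) :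
    ∃ c : ℝ, 0 < c ∧ iterPderivs r S (g ^ r) = MvPolynomial.C c * (pderivs S g) ^ r := by
  induction S using Finset.induction_on with
  | empty => exact ⟨1, one_pos, by rw [← iterPderivs_one]; simp⟩
  | insert i S hi ih =>
    obtain ⟨c, hc, h⟩ := ih
    have h1 := (Derivation.iterate_prod_of_sq_eq_zero (MvPolynomial.pderiv (R := ℝ) i)
      (Finset.univ : Finset (Fin r)) (fun _ => pderivs S g) (fun _ _ => by
        simpa [hi] using (hs.pderivs S).iterate_pderiv_eq_zero i)).2.1
    simp only [Finset.prod_const, Finset.card_univ, Fintype.card_fin] at h1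
    refine ⟨c * r.factorial, by positivity, ?_⟩
    rw [iterPderivs_insert r hi, h, ← pderiv_pderivs hi, iterate_pderiv_C_mul, h1]
    simp only [MvPolynomial.C_mul, map_natCast]
    ring

theorem shiftBounds_empty (hr : 2 ≤ r) (hs : StableOfDegree g fun _ => 1) (hg : MultiAffine g)
    (h1 : MvPolynomial.coeff (expOf Finset.univ) g = 1)
    (hroots : ∀ x : ℝ, (diagPoly g).IsRoot x → x ∈ Set.Icc (0 : ℝ) 1) {α : ℝ}
    (hα : ∀ i : Fin n, |MvPolynomial.coeff (expOf ({i} : Finset (Fin n))ᶜ) g| ≤ α)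
    {b : ℝ} (hb : 1 < b) (δ : ℝ) (S : Finset (Fin n)) :
    ShiftBounds r g b δ (r * (1 / b + α / (b * (b - 1)))) ∅ S := by
  obtain ⟨c, hc, h⟩ := iterPderivs_pow hs r S
  have hm : mixedPderivs r ∅ S g = MvPolynomial.C c * (pderivs S g) ^ r := by
    rw [mixedPderivs, iterPderivs_empty, h]
  have hpt : shiftPoint b δ (∅ : Finset (Fin n)) = fun _ => b := by
    funext i; simp [shiftPoint]
  obtain ⟨hF, hbd⟩ := pderivs_diagonal_bounds hs hg h1 hroots hα hb S
  refine ⟨?_, fun i _ hi x hx => ?_, fun i _ hi => ?_⟩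
  · rw [hm, hpt]
    simp only [map_mul, map_pow, MvPolynomial.aeval_C, Algebra.algebraMap_self, RingHom.id_apply]
    positivity
  · rw [hm, hpt] at hx
    simp only [map_mul, map_pow, MvPolynomial.aeval_C, Algebra.algebraMap_self, RingHom.id_apply,
      mul_eq_zero, hc.ne', false_or] at hx
    replace hx := eq_zero_of_pow_eq_zero hx
    have hst := hs.pderivs S
    have hdeg : (slice i (fun _ => b) (pderivs S g)).natDegree ≤ 1 := by
      simpa [hi] using hst.natDegree_slice_le i (fun _ => b)
    obtain ⟨u, v, huv⟩ := Polynomial.exists_eq_X_add_C_of_natDegree_le_one hdeg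
    have e1 := eval_slice i (fun _ => b) (pderivs S g) x
    have e2 := eval_slice i (fun _ => b) (pderivs S g) b
    have e3 := eval_slice i (fun _ => b) (MvPolynomial.pderiv i (pderivs S g)) b
    rw [← derivative_slice] at e3
    rw [Function.update_eq_self_iff.mpr rfl] at e2 e3
    rw [huv] at e1 e2 e3
    rw [hx] at e1
    rw [pderiv_pderivs hi] at e3
    simp only [Polynomial.eval_add, Polynomial.eval_mul, Polynomial.eval_C, Polynomial.eval_X,
      Polynomial.derivative_add, Polynomial.derivative_C_mul, Polynomial.derivative_X,
      Polynomial.derivative_C, mul_one, add_zero] at e1 e2 e3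
    have := (hbd i hi).1
    rw [← e2] at this hF
    rw [← e3] at this
    have hu : 0 < u := by nlinarith
    constructor
    · by_contra! h0
      nlinarith
    · by_contra! h0
      nlinarith
  · rw [hm, hpt, MvPolynomial.pderiv_C_mul, Derivation.leibniz_pow, pderiv_pderivs hi]
    simp only [map_mul, map_pow, MvPolynomial.aeval_C, Algebra.algebraMap_self, RingHom.id_apply,
      smul_eq_mul, nsmul_eq_mul, map_natCast]
    set F := MvPolynomial.aeval (fun _ => b) (pderivs S g)
    set H := MvPolynomial.aeval (fun _ => b) (pderivs (insert i S) g)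
    have h2 : F ^ r = F ^ (r - 1) * F := by rw [← pow_succ]; congr 1; omega
    rw [h2]
    have h3 : 0 ≤ c * r * F ^ (r - 1) := by positivity
    have h4 := mul_le_mul_of_nonneg_left (hbd i hi).2 h3
    linarith

theorem shiftBounds (hr : 2 ≤ r) (hs : StableOfDegree g fun _ => 1) (hg : MultiAffine g)
    (h1 : MvPolynomial.coeff (expOf Finset.univ) g = 1)
    (hroots : ∀ x : ℝ, (diagPoly g).IsRoot x → x ∈ Set.Icc (0 : ℝ) 1) {α : ℝ}
    (hα : ∀ i : Fin n, |MvPolynomial.coeff (expOf ({i} : Finset (Fin n))ᶜ) g| ≤ α)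
    {b δ : ℝ} (hb : 1 < b)
    (hδ : r * δ * (r * (1 / b + α / (b * (b - 1))) - 1 / b) ≤ (r - 1) ^ 2)
    (T : Finset (Fin n)) {S : Finset (Fin n)} (hTS : Disjoint T S) :
    ShiftBounds r g b δ (r * (1 / b + α / (b * (b - 1)))) T S := by
  induction T using Finset.induction_on generalizing S with
  | empty => exact shiftBounds_empty hr hs hg h1 hroots hα hb δ S
  | insert j T hj ih => exact shiftBounds_insert hr hs hδ (fun _ => ih) hj hTS

end Induction

section Partitions

variable {n : ℕ} {g : MvPolynomial (Fin n) ℝ} {r : ℕ}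

/-- The product over `k` of the derivatives of `g` in the variables of `T` not assigned to `k`. -/
noncomputable def colouredPderivs (g : MvPolynomial (Fin n) ℝ) (T : Finset (Fin n))
    (σ : Fin n → Fin r) : MvPolynomial (Fin n) ℝ :=
  ∏ k, pderivs (T.filter fun i => σ i ≠ k) g

theorem sum_sum_update {M : Type*} [AddCommMonoid M] (i : Fin n) (F : (Fin n → Fin r) → M) :
    ∑ σ : Fin n → Fin r, ∑ j, F (Function.update σ i j) = r • ∑ σ, F σ := by
  let e : (Fin n → Fin r) × Fin r → (Fin n → Fin r) × Fin r :=
    fun q => (Function.update q.1 i q.2, q.1 i)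
  have he : Function.Involutive e := fun q => by simp [e]
  calc _ = ∑ q : (Fin n → Fin r) × Fin r, F (Function.update q.1 i q.2) := by
        rw [Fintype.sum_prod_type]
    _ = ∑ q : (Fin n → Fin r) × Fin r, F q.1 :=
        Fintype.sum_equiv (he.toPerm e) _ _ fun q => rfl
    _ = _ := by
        rw [Fintype.sum_prod_type]
        simp [Finset.smul_sum]

theorem iterate_pderiv_sum {ι : Type*} (i : Fin n) (m : ℕ) (s : Finset ι)
    (f : ι → MvPolynomial (Fin n) ℝ) :
    (MvPolynomial.pderiv i)^[m] (∑ k ∈ s, f k) = ∑ k ∈ s, (MvPolynomial.pderiv i)^[m] (f k) := by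
  induction m with
  | zero => rfl
  | succ m ih => simp only [Function.iterate_succ_apply', ih, map_sum]

theorem iterate_pderiv_colouredPderivs (hr : 2 ≤ r) (hs : StableOfDegree g fun _ => 1)
    {i : Fin n} {T : Finset (Fin n)} (hi : i ∉ T) (σ : Fin n → Fin r) :
    (MvPolynomial.pderiv i)^[r - 1] (colouredPderivs g T σ) =
      MvPolynomial.C ((r - 1).factorial : ℝ) *
        ∑ j, colouredPderivs g (insert i T) (Function.update σ i j) := by
  have : Nonempty (Fin r) := ⟨⟨0, by omega⟩⟩
  have hmem : ∀ k, i ∉ T.filter fun m => σ m ≠ k := fun k h => hi (Finset.mem_of_mem_filter _ h)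
  have h := (Derivation.iterate_prod_of_sq_eq_zero (MvPolynomial.pderiv (R := ℝ) i)
    (Finset.univ : Finset (Fin r)) (fun k => pderivs (T.filter fun m => σ m ≠ k) g)
    (fun k _ => by simpa [hi] using (hs.pderivs (T.filter fun m => σ m ≠ k)).iterate_pderiv_eq_zero i)).2.2
    Finset.univ_nonempty
  rw [Finset.card_univ, Fintype.card_fin] at h
  rw [colouredPderivs, h, map_natCast]
  congr 1
  refine Finset.sum_congr rfl fun j _ => ?_
  rw [colouredPderivs, ← Finset.mul_prod_erase _ _ (Finset.mem_univ j)]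
  have hT : ∀ k, (T.filter fun m => Function.update σ i j m ≠ k) = T.filter fun m => σ m ≠ k :=
    fun k => Finset.filter_congr fun m hm => by
      rw [Function.update_of_ne (ne_of_mem_of_not_mem hm hi)]
  congr 1
  · rw [Finset.filter_insert, if_neg (by simp), hT]
  · refine Finset.prod_congr rfl fun k hk => ?_
    rw [pderiv_pderivs (hmem k), Finset.filter_insert,
      if_pos (by simpa using (Finset.ne_of_mem_erase hk).symm), hT]

theorem exists_C_mul_mixedPderivs (hr : 2 ≤ r) (hs : StableOfDegree g fun _ => 1)
    (T : Finset (Fin n)) :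
    ∃ c : ℝ, 0 < c ∧ ∑ σ : Fin n → Fin r, colouredPderivs g T σ =
      MvPolynomial.C c * mixedPderivs r T ∅ g := by
  have hr0 : (0 : ℝ) < r := by exact_mod_cast (by omega : 0 < r)
  induction T using Finset.induction_on with
  | empty =>
    refine ⟨(r : ℝ) ^ n, by positivity, ?_⟩
    have : pderivs ∅ g = g := by rw [← iterPderivs_one, iterPderivs_empty]
    simp [colouredPderivs, mixedPderivs, this]
  | insert i T hi ih =>
    obtain ⟨c, hc, h⟩ := ih
    have hf : (0 : ℝ) < (r - 1).factorial := by exact_mod_cast Nat.factorial_pos _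
    have h1 := congrArg (MvPolynomial.pderiv i)^[r - 1] h
    rw [iterate_pderiv_C_mul, ← mixedPderivs_insert_left hi, iterate_pderiv_sum] at h1
    simp only [iterate_pderiv_colouredPderivs hr hs hi] at h1
    rw [← Finset.mul_sum, sum_sum_update, nsmul_eq_mul] at h1
    set a : ℝ := (r - 1).factorial * r with ha
    have ha0 : 0 < a := by positivity
    refine ⟨c * a⁻¹, by positivity, ?_⟩
    have h2 : (MvPolynomial.C a⁻¹ : MvPolynomial (Fin n) ℝ) * MvPolynomial.C a = 1 := by
      rw [← MvPolynomial.C_mul, inv_mul_cancel₀ ha0.ne', MvPolynomial.C_1]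
    rw [MvPolynomial.C_mul, mul_comm (MvPolynomial.C c), mul_assoc, ← h1, ← mul_assoc,
      ← mul_assoc, mul_assoc (MvPolynomial.C a⁻¹), ← map_natCast MvPolynomial.C r,
      ← MvPolynomial.C_mul, ← ha, h2, one_mul]

theorem gSum_eq (r : ℕ) (g : MvPolynomial (Fin n) ℝ) :
    gSum r g = ∑ σ : Fin n → Fin r, diagPoly (colouredPderivs g Finset.univ σ) := by
  symm
  refine Finset.sum_nbij (fun σ k => Finset.univ.filter fun i => σ i = k) (fun σ _ => ?_)
    (fun σ _ τ _ h => ?_) (fun S hS => ?_) (fun σ _ => ?_)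
  · simp only [Partitions, Finset.mem_filter, Finset.mem_univ, true_and]
    refine ⟨fun i j hij => Finset.disjoint_left.mpr fun m h1 h2 => hij ?_, fun m => ⟨σ m, by simp⟩⟩
    simp only [Finset.mem_filter, Finset.mem_univ, true_and] at h1 h2
    rw [← h1, h2]
  · funext i
    have h1 := congrFun h (τ i)
    have h2 : i ∈ Finset.univ.filter fun m => τ m = τ i := by simp
    simp only at h1
    rw [← h1] at h2
    simpa using h2
  · simp only [Partitions, Finset.coe_filter, Finset.mem_univ, true_and, Set.mem_ofPred_eq] at hS
    choose σ hσ using hS.2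
    refine ⟨σ, by simp, ?_⟩
    funext k
    ext i
    simp only [Finset.mem_filter, Finset.mem_univ, true_and]
    refine ⟨fun h => h ▸ hσ i, fun h => ?_⟩
    by_contra hne
    exact Finset.disjoint_left.mp (hS.1 _ _ hne) (hσ i) h
  · simp only [gPart, colouredPderivs, diagPoly, map_prod]
    refine Finset.prod_congr rfl fun k _ => ?_
    congr 2
    ext i
    simp

theorem eval_gSum_pos (hr : 2 ≤ r) (hs : StableOfDegree g fun _ => 1) {x : ℝ}
    (h : 0 < MvPolynomial.aeval (fun _ => x) (mixedPderivs r Finset.univ ∅ g)) :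
    0 < (gSum r g).eval x := by
  obtain ⟨c, hc, h1⟩ := exists_C_mul_mixedPderivs hr hs Finset.univ
  have h2 := congrArg (MvPolynomial.aeval fun _ => x) h1
  rw [gSum_eq, Polynomial.eval_finsetSum]
  simp only [eval_diagPoly]
  rw [← map_sum, h2, map_mul, MvPolynomial.aeval_C]
  exact mul_pos hc h

end Partitions

theorem exists_shift_parameters {r A B x : ℝ} (hr : 2 ≤ r) (hA : 0 < A) (hB : 0 < B)
    (hAB : r * A ^ 2 + r * B ^ 2 / (r - 1) = 1) (hBA : B ≤ (r - 1) * A) (hx : (A + B) ^ 2 < x) :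
    ∃ b δ : ℝ, 1 < b ∧ b - δ = x ∧
      r * δ * (r * (1 / b + B ^ 2 / (b * (b - 1))) - 1 / b) ≤ (r - 1) ^ 2 := by
  have hs : 0 < r - 1 := by linarith
  set c := r * A * (A + B) with hc
  set δ := (A + B) * ((r - 1) * A - B) with hδ
  set η := x - (A + B) ^ 2 with hη
  have hη0 : 0 < η := by linarith
  have hδ0 : 0 ≤ δ := mul_nonneg (by linarith) (by linarith)
  have hAB' : r * ((r - 1) * A ^ 2 + B ^ 2) = r - 1 := by
    field_simp at hAB
    linarith
  have hc1 : (r - 1) * (c - 1) = r * B * ((r - 1) * A - B) := by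
    rw [hc]; linear_combination hAB'
  have hc1' : 1 ≤ c := by
    have : 0 ≤ (r - 1) * (c - 1) := by
      rw [hc1]; exact mul_nonneg (by positivity) (by linarith)
    have := nonneg_of_mul_nonneg_right this hs
    linarith
  have heq : r * δ * ((r - 1) * (c - 1) + r * B ^ 2) = (r - 1) ^ 2 * c * (c - 1) := by
    have : (r - 1) ^ 2 * c * (c - 1) = (r - 1) * c * ((r - 1) * (c - 1)) := by ring
    rw [this, hc1, hc, hδ]
    ring
  have hδc : r * δ ≤ (r - 1) * c := by
    rw [hδ, hc]
    have : 0 ≤ r * (A + B) * B := by positivity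
    nlinarith
  refine ⟨c + η, δ, by linarith, by rw [hη, hc, hδ]; ring, ?_⟩
  have hb : 0 < c + η := by linarith
  have hb1 : 0 < c + η - 1 := by linarith
  have h1 : r * (1 / (c + η) + B ^ 2 / ((c + η) * (c + η - 1))) - 1 / (c + η) =
      ((r - 1) * (c + η - 1) + r * B ^ 2) / ((c + η) * (c + η - 1)) := by
    field_simp
    ring
  rw [h1, ← mul_div_assoc, div_le_iff₀ (by positivity)]
  have h2 : 0 ≤ η * (r - 1) * ((r - 1) * (2 * c - 1) - r * δ) := by
    refine mul_nonneg (by positivity) ?_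
    nlinarith
  have h3 : 0 ≤ (r - 1) ^ 2 * η ^ 2 := by positivity
  linarith

theorem stmt5 (r : ℕ) (hr : 2 ≤ r) (α : ℝ) (hα0 : 0 < α)
    (hα1 : α ≤ ((r : ℝ) - 1) ^ 2 / (r : ℝ) ^ 2)
    (n : ℕ) (g : MvPolynomial (Fin n) ℝ)
    (hstable : RealStable g) (hma : MultiAffine g)
    (hroots : ∀ x : ℝ, (diagPoly g).IsRoot x → x ∈ Set.Icc (0 : ℝ) 1)
    (ha0 : MvPolynomial.coeff (expOf (Finset.univ : Finset (Fin n))) g = 1)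
    (hai : ∀ i : Fin n, |MvPolynomial.coeff (expOf ({i} : Finset (Fin n))ᶜ) g| ≤ α) :
    ∀ x : ℝ, (gSum r g).IsRoot x →
      x ≤ (Real.sqrt (1 / (r : ℝ) - α / ((r : ℝ) - 1)) + Real.sqrt α) ^ 2 := by
  intro x hx
  by_contra! hlt
  have hr2 : (2 : ℝ) ≤ r := by exact_mod_cast hr
  have hr1 : (0 : ℝ) < (r : ℝ) - 1 := by linarith
  have hr0 : (0 : ℝ) < r := by linarith
  have hA : (1 / (r : ℝ)) ^ 2 ≤ 1 / (r : ℝ) - α / ((r : ℝ) - 1) := by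
    have h1 : α / ((r : ℝ) - 1) ≤ ((r : ℝ) - 1) / (r : ℝ) ^ 2 := by
      rw [div_le_iff₀ hr1]
      exact hα1.trans_eq (by ring)
    have h2 : 1 / (r : ℝ) - ((r : ℝ) - 1) / (r : ℝ) ^ 2 = (1 / (r : ℝ)) ^ 2 := by
      field_simp
      ring
    linarith
  have hA1 := Real.le_sqrt_of_sq_le hA
  have hA2 := Real.sq_sqrt ((sq_nonneg _).trans hA)
  have hB1 : Real.sqrt α ≤ ((r : ℝ) - 1) / r :=
    Real.sqrt_le_iff.mpr ⟨by positivity, by rwa [div_pow]⟩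
  have hB2 := Real.sq_sqrt hα0.le
  obtain ⟨b, δ, hb, hbx, hδ⟩ := exists_shift_parameters hr2
    ((by positivity : (0 : ℝ) < 1 / r).trans_le hA1) (Real.sqrt_pos.mpr hα0)
    (by rw [hA2, hB2]; field_simp; ring)
    (hB1.trans (by
      have := mul_le_mul_of_nonneg_left hA1 hr1.le
      rwa [mul_one_div] at this)) hlt
  rw [hB2] at hδ
  have hs := stableOfDegree_one hstable hma ha0
  have h1 := (shiftBounds hr hs hma ha0 hroots hai hb hδ Finset.univ
    (Finset.disjoint_empty_right _)).pos
  have hpt : shiftPoint b δ (Finset.univ : Finset (Fin n)) = fun _ => x := by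
    funext i; simp [shiftPoint, hbx]
  rw [hpt] at h1
  exact (eval_gSum_pos hr hs h1).ne' hx
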